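/- arXiv:2512.14890 — 3 statements merged into one kernel-verified Lean document; each statement's English description precedes it below -/
import Mathlib

section
/- There is an absolute constant C > 0 with the following property: for every positive integer t, every tree T on t+1 vertices, and every finite simple graph G on n vertices with average degree d = 2|E(G)|/n ≥ C·t⁴, the number of injective homomorphisms from T to G is at least n·d(d−1)···(d−t+1). -/
/-- Number of injective graph homomorphisms ("labeled copies") from `T` to `G`. -/
noncomputable def monCount {α β : Type} (T : SimpleGraph α) (G : SimpleGraph β) : ℕ :=
  Nat.card {f : α → β // Function.Injective f ∧ ∀ ⦃u v : α⦄, T.Adj u v → G.Adj (f u) (f v)}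

/-- Average degree `d = 2|E(G)|/n` of a finite graph. -/
noncomputable def avgDeg {β : Type} [Fintype β] (G : SimpleGraph β) : ℝ :=
  2 * (Nat.card G.edgeSet) / (Fintype.card β)

/-- Falling factorial `(x)_t = x(x-1)⋯(x-t+1)` of a real number. -/
noncomputable def fallFact (x : ℝ) (t : ℕ) : ℝ := ∏ i ∈ Finset.range t, (x - (i : ℝ))


namespace TreeCount
open Finset
open scoped Classical
set_option linter.unusedSectionVars false

section
variable {α β : Type} [Fintype α] [Fintype β]

noncomputable def dgr (G : SimpleGraph β) (v : β) : ℝ := (G.degree v : ℝ)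

noncomputable def degS (T : SimpleGraph α) (S : Finset α) (j : α) : ℕ :=
  (S.filter (fun b => T.Adj j b)).card

def homS (T : SimpleGraph α) (G : SimpleGraph β) (S : Finset α) (φ : α → β) : Prop :=
  ∀ a ∈ S, ∀ b ∈ S, T.Adj a b → G.Adj (φ a) (φ b)

noncomputable def wS (T : SimpleGraph α) (G : SimpleGraph β) (D : ℝ) (S : Finset α)
    (φ : α → β) : ℝ :=
  (Fintype.card β : ℝ) ^ S.card / ((Fintype.card β : ℝ) * D * (Fintype.card β : ℝ) ^ Fintype.card α)
    * (if homS T G S φ then 1 else 0) * ∏ j ∈ S, dgr G (φ j) / dgr G (φ j) ^ degS T S j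

noncomputable def ES (T : SimpleGraph α) (G : SimpleGraph β) (D : ℝ) (S : Finset α)
    (F : (α → β) → ℝ) : ℝ := ∑ φ, wS T G D S φ * F φ

/-- leaf extension -/
def Leaf (T : SimpleGraph α) (S : Finset α) (i u : α) : Prop :=
  i ∉ S ∧ u ∈ S ∧ T.Adj i u ∧ ∀ b ∈ S, T.Adj i b → b = u

noncomputable def zz (G : SimpleGraph β) (D : ℝ) (v : β) : ℝ := 1 - D / dgr G v

noncomputable def II (S : Finset α) (φ : α → β) : ℝ := if Set.InjOn φ (S : Set α) then 1 else 0

noncomputable def mm (G : SimpleGraph β) (S : Finset α) (u : α) (φ : α → β) : ℝ :=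
  (((S.erase u).filter (fun b => ¬ G.Adj (φ u) (φ b))).card : ℝ)

theorem sum_update (K : (α → β) → ℝ) (i : α) :
    ∑ φ, ∑ w, K (Function.update φ i w) = (Fintype.card β : ℝ) * ∑ φ, K φ := by
  have inv : Function.Involutive
      (fun p : (α → β) × β => (Function.update p.1 i p.2, p.1 i)) := by
    rintro ⟨φ, w⟩
    simp
  rw [← Fintype.sum_prod_type' (f := fun φ w => K (Function.update φ i w))]
  rw [← Equiv.sum_comp inv.toPerm]
  simp only [Function.Involutive.coe_toPerm, Function.update_idem, Function.update_eq_self]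
  rw [Fintype.sum_prod_type]
  simp [Finset.mul_sum]

theorem degS_insert_self {T : SimpleGraph α} {S : Finset α} {i u : α} (h : Leaf T S i u) :
    degS T (insert i S) i = 1 := by
  obtain ⟨hi, hu, ha, hb⟩ := h
  unfold degS
  rw [Finset.card_eq_one]
  refine ⟨u, ?_⟩
  ext b
  simp only [mem_filter, mem_insert, mem_singleton]
  constructor
  · rintro ⟨rfl | h, h2⟩
    · exact absurd h2 (T.loopless.irrefl _)
    · exact hb b h h2
  · rintro rfl
    exact ⟨Or.inr hu, ha⟩

theorem degS_insert {T : SimpleGraph α} {S : Finset α} {i u : α} (h : Leaf T S i u)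
    {j : α} (hj : j ∈ S) :
    degS T (insert i S) j = degS T S j + if j = u then 1 else 0 := by
  obtain ⟨hi, hu, ha, hb⟩ := h
  unfold degS
  rw [Finset.filter_insert]
  by_cases hju : j = u
  · subst hju
    rw [if_pos ha.symm, if_pos rfl, Finset.card_insert_of_notMem]
    simp [hi]
  · rw [if_neg, if_neg hju, add_zero]
    intro h
    exact hju (hb j hj h.symm)

theorem homS_insert {T : SimpleGraph α} {G : SimpleGraph β} {S : Finset α} {i u : α}
    (h : Leaf T S i u) (φ : α → β) (w : β) :
    homS T G (insert i S) (Function.update φ i w) ↔ homS T G S φ ∧ G.Adj (φ u) w := by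
  obtain ⟨hi, hu, ha, hb⟩ := h
  have ne : ∀ a ∈ S, a ≠ i := fun a ha h => hi (h ▸ ha)
  have up : ∀ a ∈ S, Function.update φ i w a = φ a := fun a ha => by simp [ne a ha]
  constructor
  · intro h
    refine ⟨fun a haS b hbS hab => ?_, ?_⟩
    · have := h a (by simp [haS]) b (by simp [hbS]) hab
      rwa [up a haS, up b hbS] at this
    · have := h u (by simp [hu]) i (by simp) ha.symm
      rwa [up u hu, Function.update_self] at this
  · rintro ⟨h1, h2⟩ a haS b hbS hab
    rw [mem_insert] at haS hbS
    rcases haS with rfl | haS <;> rcases hbS with rfl | hbS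
    · exact absurd hab (T.loopless.irrefl _)
    · rw [up b hbS, Function.update_self, hb b hbS hab]
      exact h2.symm
    · rw [up a haS, Function.update_self, hb a haS hab.symm]
      exact h2
    · rw [up a haS, up b hbS]
      exact h1 a haS b hbS hab

theorem wS_insert {T : SimpleGraph α} {G : SimpleGraph β} {D : ℝ} {S : Finset α} {i u : α}
    (hdeg : ∀ v, 0 < dgr G v)
    (h : Leaf T S i u) (φ : α → β) (w : β) :
    wS T G D (insert i S) (Function.update φ i w)
      = (Fintype.card β : ℝ) * wS T G D S φ * (if G.Adj (φ u) w then 1 / dgr G (φ u) else 0) := by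
  have hi := h.1
  have hu := h.2.1
  have up : ∀ a ∈ S, Function.update φ i w a = φ a := fun a ha => by
    have : a ≠ i := fun h => hi (h ▸ ha)
    simp [this]
  unfold wS
  rw [Finset.prod_insert hi, degS_insert_self h, Function.update_self, Finset.card_insert_of_notMem hi]
  have e1 : ∏ j ∈ S, dgr G (Function.update φ i w j) / dgr G (Function.update φ i w j) ^ degS T (insert i S) j
      = (∏ j ∈ S, dgr G (φ j) / dgr G (φ j) ^ degS T S j) * (1 / dgr G (φ u)) := by
    have : (1 / dgr G (φ u)) = ∏ j ∈ S, (if j = u then 1 / dgr G (φ u) else 1) := by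
      rw [Finset.prod_ite_eq' S u]; simp [hu]
    rw [this, ← Finset.prod_mul_distrib]
    refine Finset.prod_congr rfl fun j hj => ?_
    rw [up j hj, degS_insert h hj]
    have := (hdeg (φ j)).ne'
    by_cases hju : j = u
    · subst hju; simp only [if_true]; field_simp; ring
    · simp [hju]
  rw [e1]
  have hw := (hdeg w).ne'
  by_cases h1 : homS T G S φ <;> by_cases h2 : G.Adj (φ u) w
  · rw [if_pos ((homS_insert h φ w).2 ⟨h1, h2⟩), if_pos h1, if_pos h2, pow_one, div_self hw]
    ring
  all_goals
    rw [if_neg (fun hh => by have := (homS_insert h φ w).1 hh; tauto)]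
    simp [h1, h2]

theorem ES_insert {T : SimpleGraph α} {G : SimpleGraph β} {D : ℝ} {S : Finset α} {i u : α}
    (hn : 0 < (Fintype.card β : ℝ)) (hdeg : ∀ v, 0 < dgr G v)
    (h : Leaf T S i u) (F : (α → β) → ℝ) :
    ES T G D (insert i S) F = ES T G D S (fun φ =>
      ∑ w, (if G.Adj (φ u) w then 1 / dgr G (φ u) else 0) * F (Function.update φ i w)) := by
  have := sum_update (fun φ => wS T G D (insert i S) φ * F φ) i
  unfold ES
  apply mul_left_cancel₀ hn.ne'
  rw [← this, Finset.mul_sum]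
  refine Finset.sum_congr rfl fun φ _ => ?_
  rw [Finset.mul_sum, Finset.mul_sum]
  refine Finset.sum_congr rfl fun w _ => ?_
  rw [wS_insert hdeg h]
  ring

theorem sum_adj (G : SimpleGraph β) (x : β) (P : β → Prop) :
    ∑ w, (if G.Adj x w then 1 / dgr G x else 0) * (if P w then 1 else 0)
      = ((univ.filter (fun w => G.Adj x w ∧ P w)).card : ℝ) / dgr G x := by
  have : ∀ w, (if G.Adj x w then 1 / dgr G x else 0) * (if P w then (1:ℝ) else 0)
      = if G.Adj x w ∧ P w then 1 / dgr G x else 0 := by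
    intro w
    by_cases h1 : G.Adj x w <;> by_cases h2 : P w <;> simp [h1, h2]
  simp only [this]
  rw [← Finset.sum_filter]
  simp [div_eq_mul_inv]

theorem card_adj (G : SimpleGraph β) (x : β) :
    ((univ.filter (fun w => G.Adj x w)).card : ℝ) = dgr G x := by
  unfold dgr
  rw [← SimpleGraph.card_neighborFinset_eq_degree, SimpleGraph.neighborFinset_eq_filter]

/-- marginalization -/
theorem ES_insert_of_inv {T : SimpleGraph α} {G : SimpleGraph β} {D : ℝ} {S : Finset α} {i u : α}
    (hn : 0 < (Fintype.card β : ℝ)) (hdeg : ∀ v, 0 < dgr G v)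
    (h : Leaf T S i u) (F : (α → β) → ℝ) (hF : ∀ φ w, F (Function.update φ i w) = F φ) :
    ES T G D (insert i S) F = ES T G D S F := by
  rw [ES_insert hn hdeg h]
  congr 1
  funext φ
  simp only [hF]
  rw [← Finset.sum_mul]
  have := sum_adj G (φ u) (fun _ => True)
  simp only [if_true, mul_one, and_true] at this
  rw [this, card_adj, div_self (hdeg _).ne', one_mul]

theorem II_update {S : Finset α} {i : α} (hi : i ∉ S) (φ : α → β) (w : β) :
    II (insert i S) (Function.update φ i w) = II S φ * (1 - if w ∈ S.image φ then 1 else 0) := by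
  unfold II
  have up : ∀ a ∈ S, Function.update φ i w a = φ a := fun a ha => by
    have : a ≠ i := fun h => hi (h ▸ ha)
    simp [this]
  have e : Set.InjOn (Function.update φ i w) ((insert i S : Finset α) : Set α) ↔
      Set.InjOn φ (S : Set α) ∧ w ∉ S.image φ := by
    rw [Finset.coe_insert, Set.injOn_insert (by simpa using hi)]
    rw [Function.update_self]
    have h1 : Set.EqOn (Function.update φ i w) φ (S : Set α) := fun a ha => up a (by simpa using ha)
    rw [h1.injOn_iff, h1.image_eq]
    simp
  by_cases h1 : Set.InjOn φ (S : Set α) <;> by_cases h2 : w ∈ S.image φ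
  · rw [if_neg (by rw [e]; tauto), if_pos h1, if_pos h2]; ring
  · rw [if_pos (by rw [e]; tauto), if_pos h1, if_neg h2]; ring
  · rw [if_neg (by rw [e]; tauto), if_neg h1, if_pos h2]; ring
  · rw [if_neg (by rw [e]; tauto), if_neg h1, if_neg h2]; ring

theorem II_mul_card {G : SimpleGraph β} {S : Finset α} {u : α} (hu : u ∈ S) (φ : α → β) :
    II S φ * ((univ.filter (fun w => G.Adj (φ u) w ∧ w ∈ S.image φ)).card : ℝ)
      = II S φ * ((S.card : ℝ) - 1 - mm G S u φ) := by
  unfold II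
  split_ifs with hinj
  swap
  · simp
  congr 1
  have e : univ.filter (fun w => G.Adj (φ u) w ∧ w ∈ S.image φ)
      = ((S.erase u).filter (fun b => G.Adj (φ u) (φ b))).image φ := by
    ext w
    simp only [mem_filter, mem_univ, true_and, mem_image, mem_erase]
    constructor
    · rintro ⟨h1, b, hb, rfl⟩
      refine ⟨b, ⟨⟨?_, hb⟩, h1⟩, rfl⟩
      rintro rfl
      exact G.loopless.irrefl _ h1
    · rintro ⟨b, ⟨⟨_, hb⟩, h1⟩, rfl⟩
      exact ⟨h1, b, hb, rfl⟩
  rw [e, Finset.card_image_of_injOn]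
  · unfold mm
    have := Finset.card_filter_add_card_filter_not (s := S.erase u) (fun b => G.Adj (φ u) (φ b))
    have h2 := Finset.card_erase_add_one hu
    rw [eq_sub_iff_add_eq, eq_sub_iff_add_eq]
    rw [← h2, ← this]
    push_cast
    ring
  · intro a ha b hb hab
    simp at ha hb
    exact hinj (by simpa using ha.1.2) (by simpa using hb.1.2) hab

theorem ES_step {T : SimpleGraph α} {G : SimpleGraph β} {D : ℝ} {S : Finset α} {i u : α}
    (hD : 0 < D)
    (hn : 0 < (Fintype.card β : ℝ)) (hdeg : ∀ v, 0 < dgr G v)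
    (h : Leaf T S i u) (F : (α → β) → ℝ) (hF : ∀ φ w, F (Function.update φ i w) = F φ) :
    ES T G D (insert i S) (fun φ => II (insert i S) φ * F φ) = ES T G D S (fun φ =>
      II S φ * (F φ * (1 - ((S.card : ℝ) - 1) / D + ((S.card : ℝ) - 1) / D * zz G D (φ u)
        + mm G S u φ * (1 - zz G D (φ u)) / D))) := by
  rw [ES_insert hn hdeg h]
  congr 1
  funext φ
  simp only [hF, II_update h.1]
  have h1 := sum_adj G (φ u) (fun _ => True)
  simp only [if_true, mul_one, and_true, card_adj] at h1
  have h2 : ∑ w, (if G.Adj (φ u) w then 1 / dgr G (φ u) else 0) * (if w ∈ S.image φ then 1 else 0)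
      = ((univ.filter (fun w => G.Adj (φ u) w ∧ w ∈ S.image φ)).card : ℝ) / dgr G (φ u) := by
    convert sum_adj G (φ u) (fun w => w ∈ S.image φ)
  have h3 := II_mul_card (G := G) h.2.1 φ
  have hd := (hdeg (φ u)).ne'
  calc _ = II S φ * F φ * ((∑ w, (if G.Adj (φ u) w then 1 / dgr G (φ u) else 0)) -
        ∑ w, (if G.Adj (φ u) w then 1 / dgr G (φ u) else 0) * (if w ∈ S.image φ then 1 else 0)) := by
        rw [← Finset.sum_sub_distrib, Finset.mul_sum]
        refine Finset.sum_congr rfl fun w _ => ?_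
        ring
    _ = F φ * (II S φ - (II S φ * ((univ.filter (fun w => G.Adj (φ u) w ∧ w ∈ S.image φ)).card : ℝ)) / dgr G (φ u)) := by
        rw [h1, h2, div_self hd]; ring
    _ = _ := by
        rw [h3]; unfold zz; field_simp; ring

theorem wS_nonneg {T : SimpleGraph α} {G : SimpleGraph β} {D : ℝ} {S : Finset α}
    (hD : 0 < D) (hdeg : ∀ v, 0 < dgr G v) (φ : α → β) : 0 ≤ wS T G D S φ := by
  unfold wS
  have : 0 ≤ ∏ j ∈ S, dgr G (φ j) / dgr G (φ j) ^ degS T S j :=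
    Finset.prod_nonneg fun j _ => by have := hdeg (φ j); positivity
  positivity

theorem ES_mono {T : SimpleGraph α} {G : SimpleGraph β} {D : ℝ} {S : Finset α}
    (hD : 0 < D) (hdeg : ∀ v, 0 < dgr G v) {F F' : (α → β) → ℝ} (h : ∀ φ, F φ ≤ F' φ) :
    ES T G D S F ≤ ES T G D S F' :=
  Finset.sum_le_sum fun φ _ => mul_le_mul_of_nonneg_left (h φ) (wS_nonneg hD hdeg φ)

theorem ES_add (T : SimpleGraph α) (G : SimpleGraph β) (D : ℝ) (S : Finset α)
    (F F' : (α → β) → ℝ) :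
    ES T G D S (fun φ => F φ + F' φ) = ES T G D S F + ES T G D S F' := by
  unfold ES; rw [← Finset.sum_add_distrib]; exact Finset.sum_congr rfl fun _ _ => by ring

theorem ES_smul (T : SimpleGraph α) (G : SimpleGraph β) (D : ℝ) (S : Finset α)
    (c : ℝ) (F : (α → β) → ℝ) :
    ES T G D S (fun φ => c * F φ) = c * ES T G D S F := by
  unfold ES; rw [Finset.mul_sum]; exact Finset.sum_congr rfl fun _ _ => by ring

theorem ES_sum (T : SimpleGraph α) (G : SimpleGraph β) (D : ℝ) (S : Finset α)
    {ι : Type} (s : Finset ι) (F : ι → (α → β) → ℝ) :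
    ES T G D S (fun φ => ∑ j ∈ s, F j φ) = ∑ j ∈ s, ES T G D S (F j) := by
  unfold ES; rw [Finset.sum_comm]; exact Finset.sum_congr rfl fun _ _ => by rw [Finset.mul_sum]

theorem ES_singleton (T : SimpleGraph α) (G : SimpleGraph β) (D : ℝ) (j : α)
    (hn : 0 < (Fintype.card β : ℝ)) (f : β → ℝ) :
    ES T G D {j} (fun φ => f (φ j)) = (∑ v, dgr G v * f v) / ((Fintype.card β : ℝ) * D) := by
  unfold ES wS
  have h1 : degS T {j} j = 0 := by simp [degS, Finset.filter_singleton]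
  have h2 : ∀ φ : α → β, homS T G {j} φ := by
    intro φ a ha b hb hab
    simp at ha hb
    subst ha; subst hb
    exact absurd hab (T.loopless.irrefl _)
  simp only [h2, if_true, Finset.prod_singleton, h1, pow_zero, div_one, Finset.card_singleton, pow_one, mul_one]
  have h3 : ∑ φ : α → β, dgr G (φ j) * f (φ j)
      = (Fintype.card β : ℝ) ^ (Fintype.card α) / (Fintype.card β : ℝ) * ∑ v, dgr G v * f v := by
    have := sum_update (fun φ : α → β => dgr G (φ j) * f (φ j)) j
    simp only [Function.update_self] at this
    rw [Finset.sum_const, Finset.card_univ, Fintype.card_fun, nsmul_eq_mul] at this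
    push_cast at this
    field_simp
    linarith
  simp only [mul_assoc]
  rw [← Finset.mul_sum, h3]
  field_simp


/-! connected vertex sets -/

def Conn (T : SimpleGraph α) (S : Finset α) : Prop :=
  ∀ a ∈ S, ∀ b ∈ S, ∃ p : T.Walk a b, ∀ x ∈ p.support, x ∈ S

theorem conn_singleton (T : SimpleGraph α) (j : α) : Conn T {j} := by
  intro a ha b hb
  simp at ha hb
  subst ha; subst hb
  exact ⟨SimpleGraph.Walk.nil, by simp⟩

theorem conn_univ {T : SimpleGraph α} (h : T.Connected) : Conn T univ := by
  intro a _ b _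
  obtain ⟨p⟩ := h.preconnected a b
  exact ⟨p, by simp⟩

theorem conn_insert {T : SimpleGraph α} {S : Finset α} {i u : α} (hS : Conn T S) (hu : u ∈ S)
    (ha : T.Adj i u) : Conn T (insert i S) := by
  have key : ∀ b ∈ S, ∃ p : T.Walk i b, ∀ x ∈ p.support, x ∈ insert i S := by
    intro b hb
    obtain ⟨p, hp⟩ := hS u hu b hb
    refine ⟨SimpleGraph.Walk.cons ha p, ?_⟩
    intro x hx
    rw [SimpleGraph.Walk.support_cons, List.mem_cons] at hx
    rcases hx with rfl | hx
    · simp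
    · simp [hp x hx]
  intro a haS b hbS
  rw [mem_insert] at haS hbS
  rcases haS with rfl | haS <;> rcases hbS with rfl | hbS
  · exact ⟨SimpleGraph.Walk.nil, by simp⟩
  · exact key b hbS
  · obtain ⟨p, hp⟩ := key a haS
    exact ⟨p.reverse, fun x hx => hp x (by simpa using hx)⟩
  · obtain ⟨p, hp⟩ := hS a haS b hbS
    exact ⟨p, fun x hx => by simp [hp x hx]⟩

theorem exists_leaf {T : SimpleGraph α} (hT : T.IsAcyclic) {S₀ S : Finset α}
    (h0 : Conn T S₀) (hne : S₀.Nonempty) (hS : Conn T S) (hsub : S₀ ⊆ S) (hneq : S₀ ≠ S) :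
    ∃ i u, Leaf T S₀ i u ∧ i ∈ S ∧ Conn T (insert i S₀) := by
  obtain ⟨a, ha⟩ := hne
  obtain ⟨b, hb, hb0⟩ := Finset.exists_of_ssubset (lt_of_le_of_ne hsub hneq)
  obtain ⟨p, hp⟩ := hS a (hsub ha) b hb
  obtain ⟨e, he, he1, he2⟩ := p.exists_boundary_dart (S₀ : Set α) (by simpa using ha) (by simpa using hb0)
  have hu : e.fst ∈ S₀ := by simpa using he1
  have hi : e.snd ∉ S₀ := by simpa using he2
  refine ⟨e.snd, e.fst, ⟨hi, hu, e.adj.symm, ?_⟩, ?_, ?_⟩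
  · intro c hc hadj
    by_contra hne
    obtain ⟨q, hq⟩ := h0 e.fst hu c hc
    have hq' : ∀ x ∈ q.toPath.1.support, x ∈ S₀ := fun x hx => hq x (q.support_toPath_subset_support hx)
    have hpath : (SimpleGraph.Walk.cons e.adj (SimpleGraph.Walk.cons hadj SimpleGraph.Walk.nil)).IsPath := by
      simp [SimpleGraph.Walk.cons_isPath_iff, hadj.ne, e.adj.ne, Ne.symm hne]
    have := (hT.subsingleton_path _ _).elim q.toPath ⟨_, hpath⟩
    apply hi
    apply hq'
    rw [this]
    simp
  · exact hp _ (p.dart_snd_mem_support_of_mem_darts he)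
  · exact conn_insert h0 hu e.adj.symm

theorem chain_ind {T : SimpleGraph α} (hT : T.IsAcyclic) {S₀ S : Finset α}
    (h0 : Conn T S₀) (hne : S₀.Nonempty) (hS : Conn T S) (hsub : S₀ ⊆ S)
    (P : Finset α → Prop) (hP : P S₀)
    (step : ∀ S₁ i u, S₀ ⊆ S₁ → Conn T S₁ → S₁.Nonempty → Leaf T S₁ i u → Conn T (insert i S₁) →
      P S₁ → P (insert i S₁)) : P S := by
  have main : ∀ k, ∀ S₁, S₀ ⊆ S₁ → S₁ ⊆ S → Conn T S₁ → (S \ S₁).card = k → P S₁ → P S := by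
    intro k
    induction k with
    | zero =>
      intro S₁ h01 h1 hc hk hP1
      rw [Finset.card_eq_zero, Finset.sdiff_eq_empty_iff_subset] at hk
      rwa [Finset.Subset.antisymm hk h1]
    | succ k ih =>
      intro S₁ h01 h1 hc hk hP1
      have hneq : S₁ ≠ S := by
        rintro rfl
        simp at hk
      obtain ⟨i, u, hl, hi, hc'⟩ := exists_leaf hT hc (hne.mono h01) hS h1 hneq
      refine ih (insert i S₁) (h01.trans (Finset.subset_insert _ _)) ?_ hc' ?_
        (step S₁ i u h01 hc (hne.mono h01) hl hc' hP1)
      · intro x hx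
        rw [mem_insert] at hx
        rcases hx with rfl | hx
        · exact hi
        · exact h1 hx
      · rw [Finset.sdiff_insert, Finset.card_erase_of_mem (by simp [hi, hl.1]), hk]
        rfl
  exact main _ S₀ (Finset.Subset.refl _) hsub h0 rfl hP

/-! recursions -/

structure Ctx (T : SimpleGraph α) (G : SimpleGraph β) (D : ℝ) : Prop where
  tree : T.IsTree
  hD : 0 < D
  hn : 0 < (Fintype.card β : ℝ)
  hmin : ∀ v, D / 4 ≤ dgr G v
  hsum : ∑ v, dgr G v = (Fintype.card β : ℝ) * D

noncomputable def pS (T : SimpleGraph α) (G : SimpleGraph β) (D : ℝ) (S : Finset α) : ℝ :=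
  ES T G D S (fun φ => II S φ * 1)
noncomputable def aS (T : SimpleGraph α) (G : SimpleGraph β) (D : ℝ) (S : Finset α) (j : α) : ℝ :=
  ES T G D S (fun φ => II S φ * zz G D (φ j))
noncomputable def bS (T : SimpleGraph α) (G : SimpleGraph β) (D : ℝ) (S : Finset α) (j : α) : ℝ :=
  ES T G D S (fun φ => II S φ * zz G D (φ j) ^ 2)
noncomputable def gS (T : SimpleGraph α) (G : SimpleGraph β) (D : ℝ) (S : Finset α) (u : α) : ℝ :=
  ES T G D S (fun φ => II S φ * (mm G S u φ * (1 - zz G D (φ u)) / D))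
noncomputable def sig (G : SimpleGraph β) (D : ℝ) : ℝ :=
  (∑ v, dgr G v * zz G D v ^ 2) / ((Fintype.card β : ℝ) * D)

variable {T : SimpleGraph α} {G : SimpleGraph β} {D : ℝ}

theorem Ctx.hdeg (c : Ctx T G D) (v : β) : 0 < dgr G v :=
  lt_of_lt_of_le (by have := c.hD; positivity) (c.hmin v)

theorem Ctx.z_lt (c : Ctx T G D) (v : β) : zz G D v < 1 := by
  have := div_pos c.hD (c.hdeg v)
  unfold zz; linarith

theorem Ctx.z_ge (c : Ctx T G D) (v : β) : -3 ≤ zz G D v := by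
  have : D / dgr G v ≤ 4 := by
    rw [div_le_iff₀ (c.hdeg v)]; linarith [c.hmin v]
  unfold zz; linarith

theorem II_nonneg (S : Finset α) (φ : α → β) : 0 ≤ II S φ := by unfold II; split_ifs <;> norm_num
theorem II_le (S : Finset α) (φ : α → β) : II S φ ≤ 1 := by unfold II; split_ifs <;> norm_num
theorem mm_nonneg (S : Finset α) (u : α) (φ : α → β) : 0 ≤ mm G S u φ := by unfold mm; positivity
theorem mm_le {S : Finset α} {u : α} (hu : u ∈ S) (φ : α → β) : mm G S u φ ≤ (S.card : ℝ) - 1 := by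
  unfold mm
  have h1 := Finset.card_filter_le (S.erase u) (fun b => ¬ G.Adj (φ u) (φ b))
  have h2 := Finset.card_erase_add_one hu
  rw [le_sub_iff_add_le]
  exact_mod_cast (by omega)

theorem II_singleton (j : α) (φ : α → β) : II {j} φ = 1 := by simp [II]

theorem pS_singleton (c : Ctx T G D) (j : α) : pS T G D {j} = 1 := by
  unfold pS
  simp only [II_singleton]
  have := ES_singleton T G D j c.hn (fun _ => 1 * 1)
  rw [this]
  have h1 := c.hsum
  have := c.hD
  have := c.hn
  simp only [mul_one, h1]
  field_simp

theorem aS_singleton (c : Ctx T G D) (j : α) : aS T G D {j} j = 0 := by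
  unfold aS
  simp only [II_singleton, one_mul]
  rw [ES_singleton T G D j c.hn (zz G D)]
  have : ∑ v, dgr G v * zz G D v = 0 := by
    have : ∀ v, dgr G v * zz G D v = dgr G v - D := by
      intro v
      have := (c.hdeg v).ne'
      unfold zz; field_simp
    simp only [this]
    rw [Finset.sum_sub_distrib, c.hsum]
    simp
  rw [this, zero_div]

theorem bS_singleton (c : Ctx T G D) (j : α) : bS T G D {j} j = sig G D := by
  unfold bS sig
  simp only [II_singleton, one_mul]
  exact ES_singleton T G D j c.hn (fun v => zz G D v ^ 2)

theorem ES_sq (c : Ctx T G D) {S : Finset α} (hS : Conn T S) {j : α} (hj : j ∈ S) :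
    ES T G D S (fun φ => zz G D (φ j) ^ 2) = sig G D := by
  refine chain_ind c.tree.isAcyclic (conn_singleton T j) (by simp) hS (by simpa using hj)
    (fun S => ES T G D S (fun φ => zz G D (φ j) ^ 2) = sig G D) ?_ ?_
  · exact ES_singleton T G D j c.hn (fun v => zz G D v ^ 2)
  · intro S₁ i u h1 _ _ hl _ ih
    rw [ES_insert_of_inv c.hn c.hdeg hl, ih]
    intro φ w
    have : j ≠ i := by
      rintro rfl
      exact hl.1 (h1 (by simp))
    simp [this]

theorem sig_nonneg (c : Ctx T G D) : 0 ≤ sig G D := by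
  unfold sig
  have := c.hD
  have : 0 ≤ ∑ v, dgr G v * zz G D v ^ 2 :=
    Finset.sum_nonneg fun v _ => by have := c.hdeg v; positivity
  positivity

theorem ES_II_sq_le (c : Ctx T G D) {S : Finset α} (hS : Conn T S) {j : α} (hj : j ∈ S) :
    bS T G D S j ≤ sig G D := by
  rw [← ES_sq c hS hj]
  refine ES_mono c.hD c.hdeg fun φ => ?_
  nlinarith [II_le S φ, sq_nonneg (zz G D (φ j))]

theorem gS_nonneg (c : Ctx T G D) (S : Finset α) (u : α) : 0 ≤ gS T G D S u := by
  unfold gS ES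
  refine Finset.sum_nonneg fun φ _ => mul_nonneg (wS_nonneg c.hD c.hdeg φ) ?_
  refine mul_nonneg (II_nonneg S φ) (div_nonneg (mul_nonneg (mm_nonneg S u φ) ?_) c.hD.le)
  linarith [c.z_lt (φ u)]

theorem step_p (c : Ctx T G D) {S : Finset α} {i u : α} (h : Leaf T S i u) :
    pS T G D (insert i S) = (1 - ((S.card : ℝ) - 1) / D) * pS T G D S
      + ((S.card : ℝ) - 1) / D * aS T G D S u + gS T G D S u := by
  unfold pS
  rw [ES_step c.hD c.hn c.hdeg h (fun _ => 1) (fun _ _ => rfl)]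
  unfold aS gS
  rw [← ES_smul, ← ES_smul, ← ES_add, ← ES_add]
  congr 1
  funext φ
  ring

theorem inv_of_mem {S : Finset α} {i u j : α} (h : Leaf T S i u) (hj : j ∈ S) (f : β → ℝ)
    (φ : α → β) (w : β) : f (Function.update φ i w j) = f (φ j) := by
  have : j ≠ i := by
    rintro rfl
    exact h.1 hj
  simp [this]

theorem card_ge {S : Finset α} {u : α} (hu : u ∈ S) : (0:ℝ) ≤ (S.card : ℝ) - 1 := by
  have : 1 ≤ S.card := Finset.card_pos.2 ⟨u, hu⟩
  have : (1:ℝ) ≤ S.card := by exact_mod_cast this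
  linarith

theorem step_a (c : Ctx T G D) {S : Finset α} {i u j : α} (hS : Conn T S) (h : Leaf T S i u)
    (hj : j ∈ S) {τ : ℝ} (hτ : 0 < τ) :
    (1 - ((S.card : ℝ) - 1) / D) * aS T G D S j - ((S.card : ℝ) - 1) / D * (1 + 1 / τ) * sig G D
      - τ * gS T G D S u ≤ aS T G D (insert i S) j := by
  have hD := c.hD
  have hq : 0 ≤ ((S.card : ℝ) - 1) / D := div_nonneg (card_ge hj) hD.le
  set q := ((S.card : ℝ) - 1) / D with hqdef
  have hb1 := ES_II_sq_le c hS hj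
  have hb2 := ES_II_sq_le c hS h.2.1
  have main : (1 - q) * aS T G D S j + (-(q * (1 / 2 + 1 / τ))) * bS T G D S j
      + (-(q / 2)) * bS T G D S u + (- τ) * gS T G D S u ≤ aS T G D (insert i S) j := by
    unfold aS
    rw [ES_step c.hD c.hn c.hdeg h (fun φ => zz G D (φ j)) (inv_of_mem h hj _)]
    unfold gS bS
    rw [← ES_smul, ← ES_smul, ← ES_smul, ← ES_smul, ← ES_add, ← ES_add, ← ES_add]
    refine ES_mono c.hD c.hdeg fun φ => ?_
    rw [← hqdef]
    set x := zz G D (φ j)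
    set y := zz G D (φ u)
    set m := mm G S u φ
    have hy1 : 0 < 1 - y := by linarith [c.z_lt (φ u)]
    have hy2 : 1 - y ≤ 4 := by linarith [c.z_ge (φ u)]
    have hm0 : 0 ≤ m := mm_nonneg S u φ
    have hm1 : m / D ≤ q := by
      rw [hqdef]; gcongr; exact mm_le h.2.1 φ
    have hm2 : 0 ≤ m / D := by positivity
    have h1 : 0 ≤ x + τ + x ^ 2 / (4 * τ) := by
      have : x + τ + x ^ 2 / (4 * τ) = (x + 2 * τ) ^ 2 / (4 * τ) := by field_simp; ring
      rw [this]; positivity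
    have h2 : m / D * (1 - y) ≤ q * 4 := mul_le_mul hm1 hy2 hy1.le hq
    have h3 : m / D * (1 - y) * (x ^ 2 / (4 * τ)) ≤ q * 4 * (x ^ 2 / (4 * τ)) :=
      mul_le_mul_of_nonneg_right h2 (by positivity)
    have h4 : 0 ≤ m / D * (1 - y) * (x + τ + x ^ 2 / (4 * τ)) :=
      mul_nonneg (mul_nonneg hm2 hy1.le) h1
    have h5 : q * 4 * (x ^ 2 / (4 * τ)) = q * (1 / τ) * x ^ 2 := by field_simp
    have h6 : 0 ≤ q * (x + y) ^ 2 := by positivity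
    have h7 : m * (1 - y) / D = m / D * (1 - y) := by ring
    have fin : (1 - q) * x + (-(q * (1 / 2 + 1 / τ))) * x ^ 2 + (-(q / 2)) * y ^ 2
        + (-τ) * (m * (1 - y) / D) ≤ x * (1 - q + q * y + m * (1 - y) / D) := by
      rw [h7]; nlinarith
    have := mul_le_mul_of_nonneg_left fin (II_nonneg S φ)
    linarith
  have hσ := sig_nonneg c
  have e1 : q * (1 / 2 + 1 / τ) * bS T G D S j ≤ q * (1 / 2 + 1 / τ) * sig G D :=
    mul_le_mul_of_nonneg_left hb1 (by positivity)
  have e2 : q / 2 * bS T G D S u ≤ q / 2 * sig G D :=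
    mul_le_mul_of_nonneg_left hb2 (by positivity)
  linarith

theorem step_b (c : Ctx T G D) {S : Finset α} {i u j : α} (hS : Conn T S) (h : Leaf T S i u)
    (hj : j ∈ S) :
    bS T G D S j - 4 * (((S.card : ℝ) - 1) / D) * sig G D ≤ bS T G D (insert i S) j := by
  have hD := c.hD
  have hq : 0 ≤ ((S.card : ℝ) - 1) / D := div_nonneg (card_ge hj) hD.le
  set q := ((S.card : ℝ) - 1) / D with hqdef
  have hb1 := ES_II_sq_le c hS hj
  have main : (1 - 4 * q) * bS T G D S j ≤ bS T G D (insert i S) j := by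
    unfold bS
    rw [ES_step c.hD c.hn c.hdeg h (fun φ => zz G D (φ j) ^ 2) (inv_of_mem h hj (fun v => zz G D v ^ 2))]
    rw [← ES_smul]
    refine ES_mono c.hD c.hdeg fun φ => ?_
    rw [← hqdef]
    have hy1 : 0 < 1 - zz G D (φ u) := by linarith [c.z_lt (φ u)]
    have hy2 := c.z_ge (φ u)
    have hm0 : 0 ≤ mm G S u φ := mm_nonneg S u φ
    have h1 : 0 ≤ mm G S u φ * (1 - zz G D (φ u)) / D := by positivity
    have h2 : 1 - 4 * q ≤ 1 - q + q * zz G D (φ u) + mm G S u φ * (1 - zz G D (φ u)) / D := by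
      nlinarith
    have h3 : 0 ≤ II S φ * zz G D (φ j) ^ 2 := mul_nonneg (II_nonneg S φ) (sq_nonneg _)
    have := mul_le_mul_of_nonneg_left h2 h3
    linarith
  nlinarith


noncomputable def P0 (D : ℝ) (k : ℕ) : ℝ := ∏ i ∈ Finset.range k, (1 - (i : ℝ) / D)

noncomputable def eS (T : SimpleGraph α) (G : SimpleGraph β) (D : ℝ) (S : Finset α) : ℝ :=
  pS T G D S - P0 D (S.card - 1)

theorem step_e (c : Ctx T G D) {S : Finset α} {i u : α} (h : Leaf T S i u) :
    eS T G D (insert i S) = (1 - ((S.card : ℝ) - 1) / D) * eS T G D S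
      + ((S.card : ℝ) - 1) / D * aS T G D S u + gS T G D S u := by
  unfold eS
  rw [step_p c h, Finset.card_insert_of_notMem h.1]
  have : 1 ≤ S.card := Finset.card_pos.2 ⟨u, h.2.1⟩
  obtain ⟨k, hk⟩ : ∃ k, S.card = k + 1 := ⟨S.card - 1, by omega⟩
  rw [hk]
  simp only [Nat.add_sub_cancel]
  unfold P0
  rw [Finset.prod_range_succ]
  push_cast
  ring

theorem eS_singleton (c : Ctx T G D) (j : α) : eS T G D {j} = 0 := by
  unfold eS P0
  rw [pS_singleton c]; simp

set_option maxHeartbeats 2000000 in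
theorem core (c : Ctx T G D) {t : ℕ} (ht : 2 ≤ t) (hcard : Fintype.card α = t + 1)
    (hDt : 1000 * (t : ℝ) ^ 4 ≤ D) :
    P0 D t ≤ pS T G D univ + ∑ j, ((degS T univ j : ℝ) - 1) * (aS T G D univ j + bS T G D univ j / 9) := by
  have hD := c.hD
  have hac := c.tree.isAcyclic
  have ht' : (2:ℝ) ≤ t := by exact_mod_cast ht
  have hσ := sig_nonneg c
  set σ := sig G D with hσdef
  obtain ⟨ε, hε⟩ : ∃ ε : ℝ, ε = t / D := ⟨_, rfl⟩
  have hε0 : 0 ≤ ε := by rw [hε]; positivity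
  have hε1 : 1000 * t ^ 3 * ε ≤ 1 := by
    rw [hε, ← mul_div_assoc, div_le_one hD]; linarith
  have hq : ∀ (S : Finset α) i u, Leaf T S i u → 0 ≤ ((S.card : ℝ) - 1) / D ∧ ((S.card : ℝ) - 1) / D ≤ ε := by
    intro S i u h
    refine ⟨div_nonneg (card_ge h.2.1) hD.le, ?_⟩
    rw [hε]
    gcongr
    have : S.card < Fintype.card α := by
      rw [← Finset.card_univ]
      exact Finset.card_lt_card (Finset.ssubset_univ_iff.2 (fun hh => h.1 (hh ▸ mem_univ i)))
    have : S.card ≤ t := by omega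
    have : (S.card : ℝ) ≤ t := by exact_mod_cast this
    linarith
  have hcard' : ∀ S : Finset α, (S.card : ℝ) - 1 ≤ t := by
    intro S
    have h1 := Finset.card_le_univ S
    rw [hcard] at h1
    have : (S.card : ℝ) ≤ t + 1 := by exact_mod_cast h1
    linarith
  have hεt : 1000 * (t * ε) ≤ 1 := by
    have : t * ε ≤ t ^ 3 * ε := by
      refine mul_le_mul_of_nonneg_right ?_ hε0
      exact le_self_pow₀ (by linarith) (by norm_num)
    linarith
  have hne : Nonempty α := Fintype.card_pos_iff.1 (by omega)
  obtain ⟨a0⟩ := hne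
  -- maxima
  obtain ⟨Sm, hSm, hmax⟩ := Finset.exists_max_image
    (univ.filter (fun S : Finset α => Conn T S ∧ S.Nonempty)) (fun S => eS T G D S)
    ⟨{a0}, by simp [conn_singleton]⟩
  obtain ⟨Am, hAm, hAmax⟩ := Finset.exists_max_image
    (univ.filter (fun x : Finset α × α => Conn T x.1 ∧ x.2 ∈ x.1)) (fun x => - aS T G D x.1 x.2)
    ⟨({a0}, a0), by simp [conn_singleton]⟩
  obtain ⟨E, hE⟩ : ∃ E, E = eS T G D Sm := ⟨_, rfl⟩
  obtain ⟨A, hA⟩ : ∃ A, A = - aS T G D Am.1 Am.2 := ⟨_, rfl⟩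
  simp only [mem_filter, mem_univ, true_and] at hSm hmax hAm hAmax
  have hE' : ∀ S, Conn T S → S.Nonempty → eS T G D S ≤ E := fun S h1 h2 => hE ▸ hmax S ⟨h1, h2⟩
  have hA' : ∀ S j, Conn T S → j ∈ S → - aS T G D S j ≤ A := fun S j h1 h2 => hA ▸ hAmax (S, j) ⟨h1, h2⟩
  have hE0 : 0 ≤ E := by rw [← eS_singleton c a0]; exact hE' _ (conn_singleton T a0) (by simp)
  have hA0 : 0 ≤ A := by
    have := hA' _ a0 (conn_singleton T a0) (by simp)
    rwa [aS_singleton c, neg_zero] at this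
  obtain ⟨τ, hτ⟩ : ∃ τ : ℝ, τ = 1 / (8 * t) := ⟨_, rfl⟩
  have hτ0 : 0 < τ := by rw [hτ]; positivity
  have hτt : t * τ = 1 / 8 := by rw [hτ]; field_simp
  have hτi : 1 / τ = 8 * t := by rw [hτ]; field_simp
  -- first chain
  have chain1 : ∀ S j, Conn T S → j ∈ S → ∃ Γ : ℝ, 0 ≤ Γ ∧
      Γ ≤ eS T G D S + ((S.card : ℝ) - 1) * (ε * (E + A)) ∧
      - aS T G D S j ≤ τ * Γ + ((S.card : ℝ) - 1) * (ε * (1 + 1 / τ) * σ) := by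
    intro S j hS hj
    refine (chain_ind hac (conn_singleton T j) (by simp) hS (by simpa using hj)
      (fun S => ∃ Γ : ℝ, 0 ≤ Γ ∧
      Γ ≤ eS T G D S + ((S.card : ℝ) - 1) * (ε * (E + A)) ∧
      - aS T G D S j ≤ τ * Γ + ((S.card : ℝ) - 1) * (ε * (1 + 1 / τ) * σ)) ?_ ?_)
    · refine ⟨0, le_rfl, ?_, ?_⟩
      · rw [eS_singleton c]; simp
      · rw [aS_singleton c]; simp
    · rintro S₁ i u hj1 hc1 hne1 hl hc2 ⟨Γ, h1, h2, h3⟩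
      have hjS : j ∈ S₁ := hj1 (by simp)
      obtain ⟨q0, q1⟩ := hq S₁ i u hl
      have hs0 := card_ge hjS
      have hg := gS_nonneg c S₁ u
      have he := step_e c hl
      have ha := step_a c hc1 hl hjS hτ0
      have hau := hA' S₁ u hc1 hl.2.1
      have heE := hE' S₁ hc1 hne1
      rw [Finset.card_insert_of_notMem hl.1]
      push_cast
      set q := ((S₁.card : ℝ) - 1) / D
      refine ⟨Γ + gS T G D S₁ u, by linarith, ?_, ?_⟩
      · have k1 : q * (eS T G D S₁ - aS T G D S₁ u) ≤ ε * (E + A) := by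
          calc q * (eS T G D S₁ - aS T G D S₁ u) ≤ q * (E + A) :=
                mul_le_mul_of_nonneg_left (by linarith) q0
            _ ≤ ε * (E + A) := mul_le_mul_of_nonneg_right q1 (by linarith)
        linarith
      · have k1 : q * (1 + 1 / τ) * σ ≤ ε * (1 + 1 / τ) * σ := by
          gcongr
        set R := τ * Γ + ((S₁.card : ℝ) - 1) * (ε * (1 + 1 / τ) * σ) with hR
        have hR0 : 0 ≤ R := by positivity
        have hε2 : ε ≤ 1 := by nlinarith
        have k2 : (1 - q) * (- aS T G D S₁ j) ≤ (1 - q) * R :=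
          mul_le_mul_of_nonneg_left h3 (by linarith)
        have k3 : 0 ≤ q * R := mul_nonneg q0 hR0
        linarith
  have hAbound : A ≤ τ * (E + t * ε * (E + A)) + t * ε * (1 + 8 * t) * σ := by
    obtain ⟨Γ, h1, h2, h3⟩ := chain1 Am.1 Am.2 hAm.1 hAm.2
    rw [← hA, hτi] at h3
    have hc := hcard' Am.1
    have he := hE' Am.1 hAm.1 ⟨_, hAm.2⟩
    have k1 : ((Am.1.card : ℝ) - 1) * (ε * (E + A)) ≤ t * (ε * (E + A)) :=
      mul_le_mul_of_nonneg_right hc (by positivity)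
    have k2 : ((Am.1.card : ℝ) - 1) * (ε * (1 + 8 * t) * σ) ≤ t * (ε * (1 + 8 * t) * σ) :=
      mul_le_mul_of_nonneg_right hc (by positivity)
    have k3 : τ * Γ ≤ τ * (E + t * ε * (E + A)) := mul_le_mul_of_nonneg_left (by linarith) hτ0.le
    linarith
  -- second chain
  have chain2 : E - t * ε * (E + A) ≤ eS T G D univ := by
    have := chain_ind hac hSm.1 hSm.2 (conn_univ c.tree.connected) (Finset.subset_univ _)
      (fun S => E - ((S.card : ℝ) - Sm.card) * (ε * (E + A)) ≤ eS T G D S) (by rw [← hE]; simp) ?_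
    · have h1 : (Sm.card : ℝ) ≥ 1 := by exact_mod_cast Finset.card_pos.2 hSm.2
      have h2 := hcard' univ
      have : (((univ : Finset α).card : ℝ) - Sm.card) * (ε * (E + A)) ≤ t * (ε * (E + A)) :=
        mul_le_mul_of_nonneg_right (by linarith) (by positivity)
      linarith
    · intro S₁ i u _ hc1 hne1 hl hc2 ih
      obtain ⟨q0, q1⟩ := hq S₁ i u hl
      have hg := gS_nonneg c S₁ u
      have he := step_e c hl
      have hau := hA' S₁ u hc1 hl.2.1
      have heE := hE' S₁ hc1 hne1
      rw [Finset.card_insert_of_notMem hl.1]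
      push_cast
      set q := ((S₁.card : ℝ) - 1) / D
      have k1 : q * (eS T G D S₁ - aS T G D S₁ u) ≤ ε * (E + A) := by
        calc q * (eS T G D S₁ - aS T G D S₁ u) ≤ q * (E + A) :=
              mul_le_mul_of_nonneg_left (by linarith) q0
          _ ≤ ε * (E + A) := mul_le_mul_of_nonneg_right q1 (by linarith)
      linarith
  -- third chain
  have chain3 : ∀ j, σ - 4 * (t * ε) * σ ≤ bS T G D univ j := by
    intro j
    have := chain_ind hac (conn_singleton T j) (by simp) (conn_univ c.tree.connected) (Finset.subset_univ _)
      (fun S => σ - 4 * (((S.card : ℝ) - 1) * ε) * σ ≤ bS T G D S j) (by rw [bS_singleton c]; simp [hσdef]) ?_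
    · have h2 := hcard' univ
      have : (((univ : Finset α).card : ℝ) - 1) * (ε * σ) ≤ t * (ε * σ) :=
        mul_le_mul_of_nonneg_right h2 (by positivity)
      linarith
    · intro S₁ i u hj1 hc1 hne1 hl hc2 ih
      obtain ⟨q0, q1⟩ := hq S₁ i u hl
      have hb := step_b c hc1 hl (hj1 (by simp) : j ∈ S₁)
      rw [Finset.card_insert_of_notMem hl.1]
      push_cast
      rw [← hσdef] at hb
      have : ((S₁.card : ℝ) - 1) / D * σ ≤ ε * σ := mul_le_mul_of_nonneg_right q1 hσ
      linarith
  -- degrees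
  have hdegsum : ∑ j, ((degS T univ j : ℝ) - 1) = t - 1 := by
    have h1 : ∀ j, degS T univ j = T.degree j := by
      intro j
      unfold degS
      rw [← SimpleGraph.card_neighborFinset_eq_degree, SimpleGraph.neighborFinset_eq_filter]
    have h2 := T.sum_degrees_eq_twice_card_edges
    have h3 := c.tree.card_edgeFinset
    rw [hcard] at h3
    have h4 : ∑ j, T.degree j = 2 * t := by rw [h2]; omega
    rw [Finset.sum_sub_distrib]
    simp only [h1]
    rw [← Nat.cast_sum, h4]
    simp [hcard]
    ring
  have hdeg1 : ∀ j, (0:ℝ) ≤ (degS T univ j : ℝ) - 1 := by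
    intro j
    have : 0 < degS T univ j := by
      have : Nontrivial α := Fintype.one_lt_card_iff_nontrivial.1 (by omega)
      obtain ⟨k, hk⟩ := c.tree.connected.preconnected.exists_adj_of_nontrivial j
      exact Finset.card_pos.2 ⟨k, by simp [hk]⟩
    have : (1:ℝ) ≤ degS T univ j := by exact_mod_cast this
    linarith
  have hsum : ((t:ℝ) - 1) * (-A + (σ - 4 * (t * ε) * σ) / 9)
      ≤ ∑ j, ((degS T univ j : ℝ) - 1) * (aS T G D univ j + bS T G D univ j / 9) := by
    rw [← hdegsum, Finset.sum_mul]
    refine Finset.sum_le_sum fun j _ => mul_le_mul_of_nonneg_left ?_ (hdeg1 j)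
    have := hA' univ j (conn_univ c.tree.connected) (mem_univ j)
    linarith [chain3 j]
  have hfin : P0 D t + eS T G D univ = pS T G D univ := by
    unfold eS
    rw [Finset.card_univ, hcard]; simp
  -- arithmetic
  obtain ⟨η, hη⟩ : ∃ η : ℝ, η = t * ε := ⟨_, rfl⟩
  rw [← hη] at hAbound chain2 hsum hεt
  have hη0 : 0 ≤ η := by rw [hη]; positivity
  have a1 : t * A ≤ 1 / 8 * (E + η * (E + A)) + t * η * (1 + 8 * t) * σ := by
    calc t * A ≤ t * (τ * (E + η * (E + A)) + η * (1 + 8 * t) * σ) :=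
          mul_le_mul_of_nonneg_left hAbound (by positivity)
      _ = (t * τ) * (E + η * (E + A)) + t * η * (1 + 8 * t) * σ := by ring
      _ = _ := by rw [hτt]
  have a2 : t * η * (1 + 8 * t) * σ ≤ 9 / 1000 * σ := by
    refine mul_le_mul_of_nonneg_right ?_ hσ
    have : t * η * (1 + 8 * t) ≤ 9 * (t ^ 3 * ε) := by
      have : t * η * (1 + 8 * t) = (t ^ 2 * (1 + 8 * t)) * ε := by rw [hη]; ring
      rw [this, ← mul_assoc]
      refine mul_le_mul_of_nonneg_right ?_ hε0
      nlinarith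
    linarith
  have a3 : η * (E + A) ≤ 1 / 1000 * (E + A) :=
    mul_le_mul_of_nonneg_right (by linarith) (by linarith)
  have a4 : η * σ ≤ 1 / 1000 * σ := mul_le_mul_of_nonneg_right (by linarith) hσ
  have a5 : A * 2 ≤ t * A := by nlinarith
  have a6 : 1 / 10 * σ ≤ ((t:ℝ) - 1) * ((σ - 4 * η * σ) / 9) := by
    have : 1 / 10 * σ ≤ (σ - 4 * η * σ) / 9 := by linarith
    nlinarith
  have a7 : ((t:ℝ) - 1) * (-A + (σ - 4 * η * σ) / 9) = -(t * A) + A + ((t:ℝ) - 1) * ((σ - 4 * η * σ) / 9) := by ring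
  linarith

theorem log_bound {y : ℝ} (h0 : 0 < y) (h4 : y ≤ 4) : Real.log y ≤ y - 1 - (y - 1) ^ 2 / 9 := by
  obtain ⟨s, hs, rfl⟩ : ∃ s : ℝ, 0 < s ∧ y = s ^ 2 :=
    ⟨Real.sqrt y, Real.sqrt_pos.2 h0, (Real.sq_sqrt h0.le).symm⟩
  have hs2 : s ≤ 2 := by nlinarith
  have h1 := Real.log_le_sub_one_of_pos hs
  rw [Real.log_pow]
  push_cast
  have : (s ^ 2 - 1) ^ 2 / 9 ≤ (s - 1) ^ 2 := by
    have : (s ^ 2 - 1) ^ 2 = (s - 1) ^ 2 * (s + 1) ^ 2 := by ring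
    rw [this]
    have : (s + 1) ^ 2 ≤ 9 := by nlinarith
    nlinarith [sq_nonneg (s - 1)]
  nlinarith

theorem prod_bound (c : Ctx T G D) (m : α → ℕ) (φ : α → β) :
    1 + ∑ j, (m j : ℝ) * (zz G D (φ j) + zz G D (φ j) ^ 2 / 9)
      ≤ ∏ j, (dgr G (φ j) / D) ^ m j := by
  have hD := c.hD
  have h1 : ∀ j, zz G D (φ j) + zz G D (φ j) ^ 2 / 9 ≤ Real.log (dgr G (φ j) / D) := by
    intro j
    have hd := c.hdeg (φ j)
    have h4 : D / dgr G (φ j) ≤ 4 := by linarith [c.z_ge (φ j), show zz G D (φ j) = 1 - D / dgr G (φ j) from rfl]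
    have := log_bound (div_pos hD hd) h4
    have e : Real.log (dgr G (φ j) / D) = - Real.log (D / dgr G (φ j)) := by
      rw [← Real.log_inv, inv_div]
    rw [e]
    unfold zz
    nlinarith
  calc _ ≤ (∑ j, (m j : ℝ) * Real.log (dgr G (φ j) / D)) + 1 := by
        rw [add_comm]
        gcongr with j
        exact h1 j
    _ ≤ Real.exp (∑ j, (m j : ℝ) * Real.log (dgr G (φ j) / D)) := Real.add_one_le_exp _
    _ = _ := by
        rw [Real.exp_sum]
        refine Finset.prod_congr rfl fun j _ => ?_
        rw [mul_comm, Real.exp_mul, Real.exp_log (div_pos (c.hdeg _) hD), Real.rpow_natCast]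

theorem main_min (c : Ctx T G D) {t : ℕ} (ht : 2 ≤ t) (hcard : Fintype.card α = t + 1)
    (hDt : 1000 * (t : ℝ) ^ 4 ≤ D) :
    (Fintype.card β : ℝ) * fallFact D t ≤ monCount T G := by
  have hD := c.hD
  have hn := c.hn
  have hcore := core c ht hcard hDt
  have hdeg1 : ∀ j, 1 ≤ degS T univ j := by
    intro j
    have : Nontrivial α := Fintype.one_lt_card_iff_nontrivial.1 (by omega)
    obtain ⟨k, hk⟩ := c.tree.connected.preconnected.exists_adj_of_nontrivial j
    exact Finset.card_pos.2 ⟨k, by simp [hk]⟩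
  obtain ⟨m, hm⟩ : ∃ m : α → ℕ, ∀ j, degS T univ j = m j + 1 :=
    ⟨fun j => degS T univ j - 1, fun j => by have := hdeg1 j; simp only; omega⟩
  have hmsum : ∑ j, m j = t - 1 := by
    have h1 : ∀ j, degS T univ j = T.degree j := by
      intro j
      unfold degS
      rw [← SimpleGraph.card_neighborFinset_eq_degree, SimpleGraph.neighborFinset_eq_filter]
    have h2 := T.sum_degrees_eq_twice_card_edges
    have h3 := c.tree.card_edgeFinset
    rw [hcard] at h3
    have h4 : ∑ j, T.degree j = 2 * t := by rw [h2]; omega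
    simp only [← h1, hm, Finset.sum_add_distrib] at h4
    simp [hcard] at h4
    omega
  have e1 : pS T G D univ + ∑ j, ((degS T univ j : ℝ) - 1) * (aS T G D univ j + bS T G D univ j / 9)
      = ES T G D univ (fun φ => II univ φ * (1 + ∑ j, (m j : ℝ) * (zz G D (φ j) + zz G D (φ j) ^ 2 / 9))) := by
    have : (fun φ : α → β => II univ φ * (1 + ∑ j, (m j : ℝ) * (zz G D (φ j) + zz G D (φ j) ^ 2 / 9)))
        = fun φ => II univ φ * 1 + ∑ j, (m j : ℝ) * (II univ φ * zz G D (φ j) + 1 / 9 * (II univ φ * zz G D (φ j) ^ 2)) := by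
      funext φ
      rw [mul_add, Finset.mul_sum]
      congr 1
      refine Finset.sum_congr rfl fun j _ => ?_
      ring
    rw [this, ES_add, ES_sum]
    unfold pS
    congr 1
    refine Finset.sum_congr rfl fun j _ => ?_
    rw [ES_smul, ES_add, ES_smul, hm]
    unfold aS bS
    push_cast
    ring
  have e2 : ES T G D univ (fun φ => II univ φ * (1 + ∑ j, (m j : ℝ) * (zz G D (φ j) + zz G D (φ j) ^ 2 / 9)))
      ≤ ES T G D univ (fun φ => II univ φ * ∏ j, (dgr G (φ j) / D) ^ m j) :=
    ES_mono c.hD c.hdeg fun φ => mul_le_mul_of_nonneg_left (prod_bound c m φ) (II_nonneg _ _)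
  have e3 : ES T G D univ (fun φ => II univ φ * ∏ j, (dgr G (φ j) / D) ^ m j)
      = (monCount T G : ℝ) / ((Fintype.card β : ℝ) * D ^ t) := by
    have hmon : (monCount T G : ℝ) = ∑ φ : α → β, II univ φ * (if homS T G univ φ then 1 else 0) := by
      unfold monCount
      rw [Nat.card_eq_fintype_card, Fintype.card_subtype, Finset.card_filter]
      push_cast
      refine Finset.sum_congr rfl fun φ _ => ?_
      unfold II homS
      have h1 : Set.InjOn φ ((univ : Finset α) : Set α) ↔ Function.Injective φ := by simp
      by_cases a : Function.Injective φ
      · rw [if_pos (h1.2 a)]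
        simp [a]
      · rw [if_neg (fun h => a (h1.1 h))]
        simp [a]
    rw [hmon, Finset.sum_div]
    unfold ES
    refine Finset.sum_congr rfl fun φ _ => ?_
    unfold wS
    have hp : (∏ j, dgr G (φ j) / dgr G (φ j) ^ degS T univ j) * ∏ j, (dgr G (φ j) / D) ^ m j
        = 1 / D ^ (t - 1) := by
      rw [← Finset.prod_mul_distrib]
      have : ∀ j, dgr G (φ j) / dgr G (φ j) ^ degS T univ j * (dgr G (φ j) / D) ^ m j = (1 / D) ^ m j := by
        intro j
        have := (c.hdeg (φ j)).ne'
        rw [hm, div_pow, div_pow, one_pow, pow_succ]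
        field_simp
      simp only [this]
      rw [Finset.prod_pow_eq_pow_sum, hmsum, one_div_pow]
    have ht1 : D ^ t = D ^ (t - 1) * D := by rw [← pow_succ]; congr 1; omega
    calc _ = (Fintype.card β : ℝ) ^ (univ : Finset α).card / ((Fintype.card β : ℝ) * D * (Fintype.card β : ℝ) ^ Fintype.card α)
          * (if homS T G univ φ then 1 else 0) * II univ φ * ((∏ j, dgr G (φ j) / dgr G (φ j) ^ degS T univ j) * ∏ j, (dgr G (φ j) / D) ^ m j) := by ring
      _ = _ := by
        rw [hp, ht1, Finset.card_univ]
        field_simp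
  have e4 : fallFact D t = D ^ t * P0 D t := by
    unfold fallFact P0
    have hpw : D ^ t = ∏ _i ∈ Finset.range t, D := by simp
    rw [hpw]
    rw [← Finset.prod_mul_distrib]
    refine Finset.prod_congr rfl fun i _ => ?_
    field_simp
  have e5 : P0 D t ≤ (monCount T G : ℝ) / ((Fintype.card β : ℝ) * D ^ t) := by
    rw [← e3]; linarith
  rw [le_div_iff₀ (by positivity)] at e5
  rw [e4]
  linarith

theorem n_mul_avgDeg (G : SimpleGraph β) (hn : 0 < (Fintype.card β : ℝ)) :
    (Fintype.card β : ℝ) * avgDeg G = 2 * (G.edgeFinset.card : ℝ) := by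
  unfold avgDeg
  rw [Nat.card_eq_fintype_card, ← SimpleGraph.edgeFinset_card]
  field_simp

theorem sum_dgr (G : SimpleGraph β) (hn : 0 < (Fintype.card β : ℝ)) :
    ∑ v, dgr G v = (Fintype.card β : ℝ) * avgDeg G := by
  rw [n_mul_avgDeg G hn]
  unfold dgr
  rw [← Nat.cast_sum, G.sum_degrees_eq_twice_card_edges]
  push_cast
  ring

theorem monCount_induce_le (T : SimpleGraph α) (G : SimpleGraph β) (s : Set β) :
    monCount T (G.induce s) ≤ monCount T G := by
  unfold monCount
  refine Nat.card_le_card_of_injective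
    (fun f => ⟨fun a => (f.1 a : β), Subtype.val_injective.comp f.2.1, fun u v h => f.2.2 h⟩) ?_
  intro f g h
  apply Subtype.ext
  funext a
  apply Subtype.ext
  exact congrFun (congrArg Subtype.val h) a

theorem fallFact_ratio {t : ℕ} {d d' : ℝ} (h0 : 0 < d) (ht : (t : ℝ) ≤ d) (h : d ≤ d') :
    (d' / d) ^ t * fallFact d t ≤ fallFact d' t := by
  unfold fallFact
  have hpw : (d' / d) ^ t = ∏ _i ∈ Finset.range t, (d' / d) := by
    rw [Finset.prod_const, Finset.card_range]
  rw [hpw, ← Finset.prod_mul_distrib]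
  refine Finset.prod_le_prod (fun i hi => ?_) fun i hi => ?_
  · have : (i : ℝ) ≤ t := by exact_mod_cast (Finset.mem_range.1 hi).le
    have : 0 ≤ d - i := by linarith
    have : 0 ≤ d' := by linarith
    positivity
  · rw [div_mul_eq_mul_div, div_le_iff₀ h0]
    have : (0:ℝ) ≤ i := by positivity
    nlinarith

theorem fallFact_nonneg {t : ℕ} {d : ℝ} (ht : (t : ℝ) ≤ d) : 0 ≤ fallFact d t := by
  unfold fallFact
  refine Finset.prod_nonneg fun i hi => ?_
  have : (i : ℝ) ≤ t := by exact_mod_cast (Finset.mem_range.1 hi).le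
  linarith

end

theorem main_ge2 {α : Type} [Fintype α] (T : SimpleGraph α) (hT : T.IsTree) {t : ℕ} (ht : 2 ≤ t)
    (hcard : Fintype.card α = t + 1) :
    ∀ (k : ℕ) (β : Type) [Fintype β] (G : SimpleGraph β), Fintype.card β = k →
      1000 * (t : ℝ) ^ 4 ≤ avgDeg G →
      (Fintype.card β : ℝ) * fallFact (avgDeg G) t ≤ (monCount T G : ℝ) := by
  intro k
  induction k with
  | zero =>
    intro β _ G h0 _
    rw [h0]; simp
  | succ k ih =>
    intro β _ G hk hd
    have ht' : (2:ℝ) ≤ t := by exact_mod_cast ht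
    have hn : 0 < (Fintype.card β : ℝ) := by rw [hk]; positivity
    have htd : 1000 * (t : ℝ) ≤ avgDeg G := by
      have : (t:ℝ) ≤ (t:ℝ) ^ 4 := le_self_pow₀ (by linarith) (by norm_num)
      linarith
    have hD : 0 < avgDeg G := by linarith
    by_cases hmin : ∀ v, avgDeg G / 4 ≤ dgr G v
    · exact main_min ⟨hT, hD, hn, hmin, sum_dgr G hn⟩ ht hcard hd
    push Not at hmin
    obtain ⟨v, hv⟩ := hmin
    set G' := G.induce ({v}ᶜ : Set β) with hG'
    have hk' : Fintype.card ({v}ᶜ : Set β) = k := by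
      rw [Fintype.card_compl_set]; simp [hk]
    have hedge : (G'.edgeFinset.card : ℝ) = (G.edgeFinset.card : ℝ) - dgr G v := by
      have h1 := G.card_edgeFinset_induce_compl_singleton v
      have h2 := G.card_edgeFinset_deleteIncidenceSet v
      have h3 : G.degree v ≤ G.edgeFinset.card := G.degree_le_card_edgeFinset v
      have h4 : G'.edgeFinset.card = G.edgeFinset.card - G.degree v := by
        rw [← h2, ← h1]
      rw [h4, Nat.cast_sub h3]
      rfl
    have hdv : 0 ≤ dgr G v := by unfold dgr; positivity
    have hsum := n_mul_avgDeg G hn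
    have hkpos : 0 < k := by
      rcases Nat.eq_zero_or_pos k with h | h
      · exfalso
        subst h
        have : Subsingleton β := Fintype.card_le_one_iff_subsingleton.1 (by omega)
        have : G.edgeFinset.card = 0 := by
          rw [Finset.card_eq_zero, SimpleGraph.edgeFinset_eq_empty]
          exact Subsingleton.elim _ _
        rw [this, hk] at hsum
        simp at hsum
        linarith
      · exact h
    have hkR : (1:ℝ) ≤ k := by exact_mod_cast hkpos
    have hn' : 0 < (Fintype.card ({v}ᶜ : Set β) : ℝ) := by rw [hk']; linarith
    have hsum' := n_mul_avgDeg G' hn'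
    have hmono := monCount_induce_le T G ({v}ᶜ : Set β)
    have hmono' : (monCount T G' : ℝ) ≤ monCount T G := by exact_mod_cast hmono
    rw [hk] at hsum
    rw [hk'] at hsum'
    have hsum2 : (k:ℝ) * avgDeg G' = 2 * ((G.edgeFinset.card : ℝ) - dgr G v) := by
      rw [← hedge]
      convert hsum' using 3
      simp only [SimpleGraph.edgeFinset_card]
      exact Fintype.card_congr (Equiv.refl _)
    push_cast at hsum
    have hrel : (k:ℝ) * avgDeg G' = (k + 1) * avgDeg G - 2 * dgr G v := by linarith
    have hge : ((k:ℝ) + 1 / 2) * avgDeg G ≤ k * avgDeg G' := by linarith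
    have hdd : avgDeg G ≤ avgDeg G' := by
      by_contra hcon
      push Not at hcon
      nlinarith
    have := ih ({v}ᶜ : Set β) G' hk' (hd.trans hdd)
    rw [hk'] at this
    refine le_trans ?_ (this.trans hmono')
    have hr := fallFact_ratio (t := t) hD (by linarith) hdd
    have hf := fallFact_nonneg (t := t) (d := avgDeg G) (by linarith)
    have hr1 : 1 ≤ avgDeg G' / avgDeg G := by rwa [le_div_iff₀ hD, one_mul]
    have hr2 : (avgDeg G' / avgDeg G) ^ 2 ≤ (avgDeg G' / avgDeg G) ^ t := pow_le_pow_right₀ hr1 ht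
    set r := avgDeg G' / avgDeg G with hrdef
    have hr3 : (k:ℝ) + 1 / 2 ≤ k * r := by
      rw [hrdef, ← mul_div_assoc, le_div_iff₀ hD]; exact hge
    have hr4 : (k:ℝ) + 1 ≤ k * r ^ 2 := by
      have : ((k:ℝ) + 1 / 2) ^ 2 ≤ (k * r) ^ 2 := by gcongr
      have h2 : (k:ℝ) * (k + 1) ≤ k * (k * r ^ 2) := by nlinarith
      exact le_of_mul_le_mul_left h2 (by linarith)
    rw [hk]
    push_cast
    calc ((k:ℝ) + 1) * fallFact (avgDeg G) t ≤ (k * r ^ t) * fallFact (avgDeg G) t := by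
          refine mul_le_mul_of_nonneg_right (hr4.trans ?_) hf
          gcongr
      _ = k * (r ^ t * fallFact (avgDeg G) t) := by ring
      _ ≤ _ := by gcongr

theorem main_one {α β : Type} [Fintype α] [Fintype β] (T : SimpleGraph α) (G : SimpleGraph β)
    (hT : T.IsTree) (hcard : Fintype.card α = 2) :
    (Fintype.card β : ℝ) * fallFact (avgDeg G) 1 ≤ (monCount T G : ℝ) := by
  rcases Nat.eq_zero_or_pos (Fintype.card β) with h0 | h0
  · rw [h0]; simp
  have hn : 0 < (Fintype.card β : ℝ) := by exact_mod_cast h0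
  have e : (Fintype.card β : ℝ) * fallFact (avgDeg G) 1 = (Fintype.card G.Dart : ℝ) := by
    unfold fallFact
    simp only [Finset.prod_range_one, Nat.cast_zero, sub_zero]
    rw [n_mul_avgDeg G hn, G.dart_card_eq_twice_card_edges]
    push_cast
    ring
  rw [e]
  have hnt : Nontrivial α := Fintype.one_lt_card_iff_nontrivial.1 (by omega)
  obtain ⟨a, b, hab⟩ := hnt.exists_pair_ne
  have hall : ∀ x : α, x = a ∨ x = b := by
    intro x
    by_contra hx
    push Not at hx
    have h3 : ({a, b, x} : Finset α).card = 3 := by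
      rw [Finset.card_eq_three]
      exact ⟨a, b, x, hab, hx.1.symm, hx.2.symm, rfl⟩
    have := Finset.card_le_univ ({a, b, x} : Finset α)
    omega
  unfold monCount
  rw [← Nat.card_eq_fintype_card]
  have : Nat.card G.Dart ≤ Nat.card {f : α → β // Function.Injective f ∧ ∀ ⦃u v : α⦄, T.Adj u v → G.Adj (f u) (f v)} := by
    refine Nat.card_le_card_of_injective
      (fun e => ⟨fun c => if c = a then e.fst else e.snd, ?_, ?_⟩) ?_
    · intro x y hxy
      have h1 := e.adj.ne
      rcases hall x with rfl | rfl <;> rcases hall y with rfl | rfl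
      · rfl
      · simp [hab.symm] at hxy
      · simp [hab.symm] at hxy
      · rfl
    · intro x y hxy
      rcases hall x with rfl | rfl <;> rcases hall y with rfl | rfl
      · exact absurd rfl hxy.ne
      · simpa [hab.symm] using e.adj
      · simpa [hab.symm] using e.adj.symm
      · exact absurd rfl hxy.ne
    · intro e e' h
      have h' := congrArg Subtype.val h
      have h1 := congrFun h' a
      have h2 := congrFun h' b
      simp [hab.symm] at h1 h2
      ext
      · exact h1
      · exact h2
  exact_mod_cast this

end TreeCount

/-- Quantitative form of Theorem 1.1: there is an absolute constant `C > 0` such that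
`d0(t) = C·t⁴` suffices for the tree-counting lower bound. -/
theorem tree_count_lower_bound_poly :
    ∃ C : ℝ, 0 < C ∧ ∀ (t : ℕ), 0 < t →
      ∀ (α β : Type) [Fintype α] [Fintype β]
        (T : SimpleGraph α) (G : SimpleGraph β),
        T.IsTree → Fintype.card α = t + 1 →
        C * (t : ℝ) ^ 4 ≤ avgDeg G →
        (Fintype.card β : ℝ) * fallFact (avgDeg G) t ≤ (monCount T G : ℝ) := by

  refine ⟨1000, by norm_num, ?_⟩
  intro t ht α β _ _ T G hT hcard hd
  rcases Nat.lt_or_ge t 2 with h | h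
  · have h1 : t = 1 := by omega
    subst h1
    exact TreeCount.main_one T G hT hcard
  · exact TreeCount.main_ge2 T hT h hcard _ β G rfl hd
end

section
/- Let t ≥ 1 be an integer, let T be a tree with t edges, and let G be a finite simple graph on n vertices with average degree d = 2|E(G)|/n ≥ t. Then the number of injective homomorphisms from T to G is at least n·(1 − t⁵/d²)·d(d−1)···(d−t+1). -/
set_option linter.unusedSectionVars false

section mvhelpers
open Finset

section integration
variable {α β : Type} [Fintype α] [Fintype β] [DecidableEq α] [DecidableEq β]

lemma mv_sum_update (v : α) (F : (α → β) → ℝ) :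
    (Fintype.card β : ℝ) * ∑ φ : α → β, F φ = ∑ φ : α → β, ∑ y : β, F (Function.update φ v y) := by
  have hinv : Function.Involutive
      (fun q : (α → β) × β => ((Function.update q.1 v q.2, q.1 v) : (α → β) × β)) := by
    rintro ⟨φ, y⟩
    simp
  have h := Equiv.sum_comp hinv.toPerm (fun q : (α → β) × β => F q.1)
  simp only [Function.Involutive.coe_toPerm] at h
  rw [Fintype.sum_prod_type, Fintype.sum_prod_type] at h
  rw [h]
  simp [Finset.mul_sum]

lemma mv_integrate_one (v : α) (A B : (α → β) → ℝ)
    (hA : ∀ φ y, A (Function.update φ v y) = A φ)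
    (hB : ∀ φ, ∑ y, B (Function.update φ v y) = 1) :
    (Fintype.card β : ℝ) * ∑ φ : α → β, A φ * B φ = ∑ φ, A φ := by
  rw [mv_sum_update v]
  refine Finset.sum_congr rfl fun φ _ => ?_
  simp only [hA]
  rw [← Finset.mul_sum, hB, mul_one]

lemma mv_integrate (rank : α → ℕ) (par : α → α) (K : β → β → ℝ) (hK : ∀ x, ∑ y, K x y = 1)
    (U : Finset α) :
    ∀ (A : (α → β) → ℝ), (∀ u ∈ U, rank (par u) < rank u) →
      (∀ u ∈ U, ∀ φ y, A (Function.update φ u y) = A φ) →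
    (Fintype.card β : ℝ) ^ U.card * ∑ φ : α → β, A φ * ∏ u ∈ U, K (φ (par u)) (φ u)
      = ∑ φ, A φ := by
  induction U using Finset.induction_on_max_value rank with
  | empty => intro A _ _; simp
  | insert a s ha hmax ih =>
    intro A hr hA
    rw [Finset.card_insert_of_notMem ha, pow_succ, mul_assoc]
    have h1 : (Fintype.card β : ℝ) *
        ∑ φ : α → β, A φ * ∏ u ∈ insert a s, K (φ (par u)) (φ u) =
        ∑ φ : α → β, A φ * ∏ u ∈ s, K (φ (par u)) (φ u) := by
      rw [← mv_integrate_one a (fun φ => A φ * ∏ u ∈ s, K (φ (par u)) (φ u))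
        (fun φ => K (φ (par a)) (φ a))]
      · congr 1
        refine Finset.sum_congr rfl fun φ _ => ?_
        rw [Finset.prod_insert ha]; ring
      · intro φ y
        simp only [hA a (Finset.mem_insert_self a s)]
        congr 1
        refine Finset.prod_congr rfl fun u hu => ?_
        have h2 := hmax u hu
        have h3 := hr u (Finset.mem_insert_of_mem hu)
        rw [Function.update_of_ne, Function.update_of_ne]
        · rintro rfl; exact ha hu
        · intro h; rw [h] at h3; omega
      · intro φ
        have h3 := hr a (Finset.mem_insert_self a s)
        have : par a ≠ a := by intro h; rw [h] at h3; omega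
        simp [Function.update_of_ne this, hK]
    rw [h1]
    exact ih A (fun u hu => hr u (Finset.mem_insert_of_mem hu))
      (fun u hu => hA u (Finset.mem_insert_of_mem hu))

lemma mv_sum_eval (p : α) (h : β → ℝ) :
    ∑ φ : α → β, h (φ p) = (Fintype.card β : ℝ) ^ (univ.erase p : Finset α).card * ∑ x, h x := by
  have := Finset.prod_univ_sum (fun _ : α => (univ : Finset β))
    (fun i x => if i = p then h x else (1 : ℝ))
  simp only [Fintype.piFinset_univ] at this
  have e : ∀ φ : α → β, (∏ i, if i = p then h (φ i) else (1 : ℝ)) = h (φ p) := by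
    intro φ; rw [Finset.prod_ite_eq' univ p (fun i => h (φ i))]; simp
  simp only [e] at this
  rw [← this, ← Finset.mul_prod_erase univ _ (Finset.mem_univ p)]
  rw [mul_comm]
  congr 1
  · rw [← Finset.prod_const]
    refine Finset.prod_congr rfl fun i hi => ?_
    simp [Finset.ne_of_mem_erase hi]
  · simp

/-- Weight of a map, rooted at `p`. -/
noncomputable def mvQ (D : β → ℝ) (K : β → β → ℝ) (p : α) (par : α → α) (φ : α → β) : ℝ :=
  D (φ p) * ∏ v ∈ univ.erase p, K (φ (par v)) (φ v)

lemma mv_marg [Nonempty β] (D : β → ℝ) (K : β → β → ℝ) (hK : ∀ x, ∑ y, K x y = 1)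
    (p : α) (par : α → α) (rank : α → ℕ) (hr : ∀ v, v ≠ p → rank (par v) < rank v) (g : β → ℝ) :
    ∑ φ : α → β, mvQ D K p par φ * g (φ p) = ∑ x, D x * g x := by
  have h := mv_integrate rank par K hK (univ.erase p) (fun φ : α → β => D (φ p) * g (φ p))
    (fun u hu => hr u (Finset.ne_of_mem_erase hu))
    (fun u hu φ y => by
      have : p ≠ u := (Finset.ne_of_mem_erase hu).symm
      simp [Function.update_of_ne this])
  rw [mv_sum_eval p (fun x => D x * g x)] at h
  have hc : (Fintype.card β : ℝ) ^ (univ.erase p : Finset α).card ≠ 0 :=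
    pow_ne_zero _ (by exact_mod_cast Fintype.card_ne_zero)
  have h := mul_left_cancel₀ hc h
  rw [← h]
  refine Finset.sum_congr rfl fun φ _ => ?_
  unfold mvQ; ring

lemma mv_pair [Nonempty β] (D : β → ℝ) (hD : ∀ x, 0 ≤ D x) (K : β → β → ℝ)
    (hK0 : ∀ x y, 0 ≤ K x y)
    (hK : ∀ x, ∑ y, K x y = 1) (J : β → ℝ) (hJ : ∀ x y, K x y ≤ J x)
    (p : α) (par : α → α) (rank : α → ℕ) (hr : ∀ v, v ≠ p → rank (par v) < rank v) (g : β → ℝ)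
    (hg : ∀ x, 0 ≤ g x) (a b : α) (hab : a ≠ b) (hb : b ≠ p) (hle : rank a ≤ rank b) :
    ∑ φ : α → β, mvQ D K p par φ * (g (φ p) * if φ a = φ b then 1 else 0) ≤
      ∑ φ : α → β, mvQ D K p par φ * (g (φ p) * J (φ (par b))) := by
  set U1 : Finset α := (univ.erase p).filter (fun v => rank b < rank v) with hU1
  set A1 : Finset α := ((univ.erase p).filter (fun v => ¬ rank b < rank v)).erase b with hA1
  have hbU : b ∉ U1 := by simp [hU1]
  have hsplit : ∀ f : α → ℝ, ∏ v ∈ univ.erase p, f v = (∏ v ∈ A1, f v) * ((∏ v ∈ U1, f v) * f b) := by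
    intro f
    rw [← Finset.prod_filter_mul_prod_filter_not (univ.erase p) (fun v => rank b < rank v) f]
    rw [← Finset.mul_prod_erase ((univ.erase p).filter (fun v => ¬ rank b < rank v)) f
      (a := b) (by simp [hb])]
    ring
  have hbp := hr b hb
  have hparb : par b ≠ b := by intro h; rw [h] at hbp; omega
  set G0 : (α → β) → ℝ := fun φ => D (φ p) * g (φ p) * ∏ v ∈ A1, K (φ (par v)) (φ v) with hG0
  have hG0n : ∀ φ, 0 ≤ G0 φ := fun φ =>
    mul_nonneg (mul_nonneg (hD _) (hg _)) (Finset.prod_nonneg fun _ _ => hK0 _ _)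
  have hind : ∀ u, rank b ≤ rank u → (u = b ∨ rank b < rank u) → u ≠ p → ∀ φ y,
      G0 (Function.update φ u y) = G0 φ := by
    intro u h1 h2 h3 φ y
    simp only [hG0, Function.update_of_ne h3.symm]
    congr 1
    refine Finset.prod_congr rfl fun v hv => ?_
    simp only [hA1, Finset.mem_erase, Finset.mem_filter, Finset.mem_univ, and_true] at hv
    have h4 := hr v hv.2.1
    rw [Function.update_of_ne, Function.update_of_ne]
    · rintro rfl
      rcases h2 with h2 | h2
      · exact hv.1 h2
      · exact hv.2.2 h2
    · intro h; rw [h] at h4; have := hv.2.2; omega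
  have hmemU : ∀ u ∈ U1, u ≠ p ∧ rank b < rank u := by
    intro u hu; simpa [hU1] using hu
  have hL := mv_integrate rank par K hK U1
    (fun φ : α → β => G0 φ * (K (φ (par b)) (φ b) * if φ a = φ b then 1 else 0))
    (fun u hu => hr u (hmemU u hu).1)
    (fun u hu φ y => by
      have h := hmemU u hu
      have e1 : par b ≠ u := by intro h'; rw [h'] at hbp; omega
      have e2 : b ≠ u := by rintro rfl; omega
      have e3 : a ≠ u := by rintro rfl; omega
      simp only [hind u h.2.le (Or.inr h.2) h.1, Function.update_of_ne e1,
        Function.update_of_ne e2, Function.update_of_ne e3])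
  have hR := mv_integrate rank par K hK (insert b U1)
    (fun φ : α → β => G0 φ * J (φ (par b)))
    (fun u hu => by
      rcases Finset.mem_insert.1 hu with rfl | hu
      · exact hbp
      · exact hr u (hmemU u hu).1)
    (fun u hu φ y => by
      rcases Finset.mem_insert.1 hu with rfl | hu
      · simp only [hind u le_rfl (Or.inl rfl) hb, Function.update_of_ne hparb]
      · have h := hmemU u hu
        have e1 : par b ≠ u := by intro h'; rw [h'] at hbp; omega
        simp only [hind u h.2.le (Or.inr h.2) h.1, Function.update_of_ne e1])
  have hM : (Fintype.card β : ℝ) * ∑ φ : α → β,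
      G0 φ * (K (φ (par b)) (φ b) * if φ a = φ b then 1 else 0) ≤
      ∑ φ : α → β, G0 φ * J (φ (par b)) := by
    rw [mv_sum_update b]
    refine Finset.sum_le_sum fun φ _ => ?_
    simp only [hind b le_rfl (Or.inl rfl) hb, Function.update_of_ne hparb, Function.update_of_ne hab,
      Function.update_self, ← Finset.mul_sum]
    refine mul_le_mul_of_nonneg_left ?_ (hG0n φ)
    simp [hJ]
  have hcpos : (0 : ℝ) < (Fintype.card β : ℝ) ^ (insert b U1).card :=
    pow_pos (by exact_mod_cast Fintype.card_pos) _
  refine le_of_mul_le_mul_left ?_ hcpos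
  have eL : ∀ φ : α → β, mvQ D K p par φ * (g (φ p) * if φ a = φ b then 1 else 0) =
      G0 φ * (K (φ (par b)) (φ b) * if φ a = φ b then 1 else 0) *
        ∏ u ∈ U1, K (φ (par u)) (φ u) := by
    intro φ; simp only [mvQ, hsplit, hG0]; ring
  have eR : ∀ φ : α → β, mvQ D K p par φ * (g (φ p) * J (φ (par b))) =
      G0 φ * J (φ (par b)) * ∏ u ∈ insert b U1, K (φ (par u)) (φ u) := by
    intro φ; rw [Finset.prod_insert hbU]; simp only [mvQ, hsplit, hG0]; ring
  simp only [eL, eR]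
  rw [hR, Finset.card_insert_of_notMem hbU, pow_succ', mul_assoc, hL]
  exact hM

end integration

section tree
lemma mv_tree_par {α : Type} [Fintype α] [DecidableEq α] (T : SimpleGraph α) [DecidableRel T.Adj]
    (hT : T.IsTree) (p : α) :
    ∃ (par : α → α) (rank : α → ℕ), (∀ v, v ≠ p → rank (par v) < rank v) ∧
      (∀ v, v ≠ p → T.Adj v (par v)) ∧ (∀ v, rank v = 0 ↔ v = p) ∧
      (Set.InjOn (fun v => s(v, par v)) (univ.erase p : Finset α)) ∧
      T.edgeFinset = (univ.erase p).image (fun v => s(v, par v)) := by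
  have hex : ∀ v, v ≠ p → ∃ w, T.Adj v w ∧ T.dist p w < T.dist p v := by
    intro v hv
    obtain ⟨q, hq⟩ := hT.connected.exists_walk_length_eq_dist v p
    cases q with
    | nil => exact absurd rfl hv
    | cons h q =>
      rename_i w
      refine ⟨w, h, ?_⟩
      have h1 := SimpleGraph.dist_le q
      rw [SimpleGraph.Walk.length_cons] at hq
      rw [SimpleGraph.dist_comm (u := p) (v := w), SimpleGraph.dist_comm (u := p) (v := v)]
      omega
  choose! par h1 h2 using hex
  have hinj : Set.InjOn (fun v => s(v, par v)) (univ.erase p : Finset α) := by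
    intro u hu v hv h
    have hu' : u ≠ p := by simpa using hu
    have hv' : v ≠ p := by simpa using hv
    simp only [Sym2.eq_iff] at h
    rcases h with h | h
    · exact h.1
    · have a1 := h2 u hu'
      have a2 := h2 v hv'
      rw [h.2] at a1
      rw [← h.1] at a2
      omega
  refine ⟨par, T.dist p, h2, h1, ?_, hinj, ?_⟩
  · intro v
    rw [hT.connected.dist_eq_zero_iff]
    exact eq_comm
  · symm
    apply Finset.eq_of_subset_of_card_le
    · intro e he
      obtain ⟨v, hv, rfl⟩ := Finset.mem_image.1 he
      simpa using h1 v (Finset.ne_of_mem_erase hv)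
    · rw [Finset.card_image_of_injOn hinj, Finset.card_erase_of_mem (Finset.mem_univ _)]
      have := hT.card_edgeFinset
      rw [Finset.card_univ]; omega
end tree
end mvhelpers

lemma mv_log_le {m : ℝ} (h0 : 0 < m) (h1 : m ≤ 1) : (m - 1 / m) / 2 ≤ Real.log m := by
  have hx : 0 ≤ - Real.log m := by have := Real.log_nonpos h0.le h1; linarith
  have h := Real.self_le_sinh_iff.2 hx
  rw [Real.sinh_eq, neg_neg, Real.exp_neg, Real.exp_log h0] at h
  rw [one_div]; linarith

/-- The test function. -/
noncomputable def mvPhi (y : ℝ) : ℝ :=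
  if y ≤ 1 then Real.log y else (1 - 1 / y) + (1 - 1 / y) ^ 2 / 2

noncomputable def mvq (y : ℝ) : ℝ := mvPhi y - 1 + 1 / y

lemma mvPhi_le_log {y : ℝ} (hy : 0 < y) : mvPhi y ≤ Real.log y := by
  unfold mvPhi
  split_ifs with h
  · exact le_rfl
  · push Not at h
    have h2 := Real.le_log_one_add_of_nonneg (x := y - 1) (by linarith)
    have e : 1 + (y - 1) = y := by ring
    rw [e] at h2
    refine le_trans ?_ h2
    rw [show y - 1 + 2 = y + 1 by ring, le_div_iff₀ (by linarith)]
    have : 2 * (y - 1) - (1 - 1 / y + (1 - 1 / y) ^ 2 / 2) * (y + 1) = (y - 1) ^ 3 / (2 * y ^ 2) := by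
      field_simp; ring
    have h3 : 0 ≤ (y - 1) ^ 3 / (2 * y ^ 2) := by
      have : 0 ≤ y - 1 := by linarith
      positivity
    linarith

lemma mvq_nonneg {y : ℝ} (hy : 0 < y) : 0 ≤ mvq y := by
  unfold mvq mvPhi
  split_ifs with h
  · have := Real.one_sub_inv_le_log_of_pos hy
    rw [one_div]; linarith
  · nlinarith [sq_nonneg (1 - 1 / y)]

/-- Polynomial core. -/
lemma mv_poly (e e0 K l z : ℝ) (he : 0 ≤ e) (hee : e ≤ e0) (he0 : e0 < 1 / 3) (hl0 : 0 ≤ l)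
    (hl1 : l ≤ 1) (hz0 : 0 ≤ z) (hz1 : z ≤ 1)
    (hc0 : 0 < 1 / 4 - e0 / 2 - l * (9 / 4 * e0 ^ 2 / (1 - 3 * e0)))
    (hc : 1 ≤ 4 * (1 / 4 - e0 / 2 - l * (9 / 4 * e0 ^ 2 / (1 - 3 * e0))) *
      (K - (1 - l) * (9 / 4 / (1 - 3 * e0)))) :
    e * (z + z ^ 2 / 2) + e ^ 2 * (z + z ^ 2 / 2) ^ 2 / (1 - 2 * (e * (z + z ^ 2 / 2))) ≤
      z ^ 2 / 4 + K * e ^ 2 := by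
  set f := z + z ^ 2 / 2 with hf
  set C := 9 / 4 / (1 - 3 * e0) with hC
  have hCpos : 0 < C := by rw [hC]; apply div_pos <;> linarith
  have hf0 : 0 ≤ f := by positivity
  have hf1 : f ≤ 3 / 2 * z := by nlinarith
  have hef : e * f ≤ 3 / 2 * e0 := by nlinarith
  have hden : 0 < 1 - 2 * (e * f) := by linarith
  have h1 : e ^ 2 * f ^ 2 / (1 - 2 * (e * f)) ≤ e ^ 2 * (C * z ^ 2) := by
    have : f ^ 2 ≤ 9 / 4 * z ^ 2 := by nlinarith
    calc e ^ 2 * f ^ 2 / (1 - 2 * (e * f)) ≤ e ^ 2 * (9 / 4 * z ^ 2) / (1 - 3 * e0) := by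
          apply div_le_div₀
          · positivity
          · exact mul_le_mul_of_nonneg_left this (sq_nonneg e)
          · linarith
          · linarith
      _ = e ^ 2 * (C * z ^ 2) := by rw [hC]; ring
  have hcc : 9 / 4 * e0 ^ 2 / (1 - 3 * e0) = C * e0 ^ 2 := by rw [hC]; ring
  rw [hcc] at hc hc0
  set c := 1 / 4 - e0 / 2 - l * (C * e0 ^ 2) with hcdef
  set k := K - (1 - l) * C with hk
  have hee2 : e ^ 2 ≤ e0 ^ 2 := pow_le_pow_left₀ he hee 2
  have hz2 : z ^ 2 ≤ 1 := by nlinarith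
  have h2 : e ^ 2 * (C * z ^ 2) ≤ l * (C * e0 ^ 2) * z ^ 2 + (1 - l) * C * e ^ 2 := by
    have a1 : l * (C * z ^ 2) * e ^ 2 ≤ l * (C * z ^ 2) * e0 ^ 2 :=
      mul_le_mul_of_nonneg_left hee2 (by positivity)
    have a2 : (1 - l) * C * e ^ 2 * z ^ 2 ≤ (1 - l) * C * e ^ 2 * 1 := by
      apply mul_le_mul_of_nonneg_left hz2
      have : 0 ≤ 1 - l := by linarith
      positivity
    nlinarith
  have h3 : e * z ≤ c * z ^ 2 + k * e ^ 2 := by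
    have hs := sq_nonneg (2 * c * z - e)
    have : 0 ≤ 4 * c * (c * z ^ 2 + k * e ^ 2 - e * z) := by nlinarith [sq_nonneg e]
    have := nonneg_of_mul_nonneg_right this (by positivity)
    linarith
  have h4 : e * (z ^ 2 / 2) ≤ e0 * (z ^ 2 / 2) := mul_le_mul_of_nonneg_right hee (by positivity)
  have : e * f = e * z + e * (z ^ 2 / 2) := by rw [hf]; ring
  rw [this]
  rw [this] at h1
  rw [hcdef, hk] at h3
  nlinarith

/-- Pointwise inequality. -/
lemma mv_point (e K : ℝ) (he : 0 ≤ e) (he1 : e < 1 / 3) (hK : 0 ≤ K)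
    (hpoly : ∀ z : ℝ, 0 ≤ z → z ≤ 1 →
      e * (z + z ^ 2 / 2) + e ^ 2 * (z + z ^ 2 / 2) ^ 2 / (1 - 2 * (e * (z + z ^ 2 / 2))) ≤
      z ^ 2 / 4 + K * e ^ 2) (y y' : ℝ) (hy : 0 < y) (hy' : 0 < y') :
    e * (max 0 (mvPhi y) / y') ≤ mvq y / 2 + mvq y' / 2 + K * e ^ 2 := by
  have q1 := mvq_nonneg hy
  have q2 := mvq_nonneg hy'
  by_cases h : y ≤ 1
  · have : mvPhi y ≤ 0 := by
      unfold mvPhi; rw [if_pos h]; exact Real.log_nonpos hy.le h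
    rw [max_eq_left this]
    have : 0 ≤ K * e ^ 2 := by positivity
    simp only [zero_div, mul_zero]; linarith
  · have hz0 : 0 ≤ 1 - 1 / y := by
      push Not at h
      have : 1 / y ≤ 1 := by rw [div_le_one hy]; exact h.le
      linarith
    have hz1 : 1 - 1 / y ≤ 1 := by
      have : 0 < 1 / y := by positivity
      linarith
    set z := 1 - 1 / y with hz
    have hphi : mvPhi y = z + z ^ 2 / 2 := by unfold mvPhi; rw [if_neg h]
    have hq : mvq y = z ^ 2 / 2 := by unfold mvq; rw [hphi, hz]; ring
    have hp := hpoly z hz0 hz1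
    rw [hphi, hq]
    set f := z + z ^ 2 / 2 with hf
    have hf0 : 0 ≤ f := by positivity
    have hf1 : f ≤ 3 / 2 := by nlinarith
    rw [max_eq_right hf0]
    have hef : e * f < 1 / 2 := by nlinarith
    have hfrac : 0 ≤ e ^ 2 * f ^ 2 / (1 - 2 * (e * f)) := by
      apply div_nonneg (by positivity); linarith
    by_cases h' : y' ≤ 1
    · have hm0 : 0 < 1 - 2 * (e * f) := by linarith
      have hm1 : 1 - 2 * (e * f) ≤ 1 := by nlinarith [mul_nonneg he hf0]
      have hl := mv_log_le hm0 hm1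
      set m := 1 - 2 * (e * f) with hm
      have hq' : mvq y' = Real.log y' - 1 + 1 / y' := by
        unfold mvq mvPhi; rw [if_pos h']
      have h5 : Real.log (m / y') ≤ m / y' - 1 := Real.log_le_sub_one_of_pos (by positivity)
      rw [Real.log_div hm0.ne' hy'.ne'] at h5
      have h6 : (m - 1 / m) / 2 = - 2 * (e * f) - 2 * (e ^ 2 * f ^ 2 / m) := by
        field_simp
        rw [hm]; ring
      have h7 : m / y' = 1 / y' - 2 * (e * (f / y')) := by rw [hm]; ring
      rw [hq']
      linarith
    · push Not at h'
      have : e * (f / y') ≤ e * f :=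
        mul_le_mul_of_nonneg_left (div_le_self hf0 h'.le) he
      linarith

lemma mv_eps (t : ℕ) (e e0 : ℝ) (he : 0 ≤ e) (he0 : 0 ≤ e0)
    (h : 4 * (t : ℝ) ^ 3 * e ^ 2 ≤ ((t : ℝ) - 1) ^ 2) (ht : 2 ≤ t)
    (hn : ((t : ℝ) - 1) ^ 2 ≤ 4 * (t : ℝ) ^ 3 * e0 ^ 2) : e ≤ e0 := by
  have : 4 * (t : ℝ) ^ 3 * e ^ 2 ≤ 4 * (t : ℝ) ^ 3 * e0 ^ 2 := h.trans hn
  have hp : 0 < 4 * (t : ℝ) ^ 3 := by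
    have : 0 < t := by omega
    positivity
  have := le_of_mul_le_mul_left this hp
  exact (pow_le_pow_iff_left₀ he he0 two_ne_zero).1 this

lemma mv_const (t : ℕ) (ht : 2 ≤ t) (e : ℝ) (he : 0 ≤ e)
    (h : 4 * (t : ℝ) ^ 3 * e ^ 2 ≤ ((t : ℝ) - 1) ^ 2) :
    ∃ K : ℝ, 0 ≤ K ∧ e < 1 / 3 ∧
     (((t : ℝ) - 1) * K + 1 / 2) * ((t : ℝ) - 1) ^ 2 ≤ 4 * (t : ℝ) ^ 3 * (1 - e) ∧
     (∀ z : ℝ, 0 ≤ z → z ≤ 1 →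
      e * (z + z ^ 2 / 2) + e ^ 2 * (z + z ^ 2 / 2) ^ 2 / (1 - 2 * (e * (z + z ^ 2 / 2))) ≤
      z ^ 2 / 4 + K * e ^ 2) := by
  have key : ∀ e0 K l : ℝ, 0 ≤ e0 → 0 ≤ K → e0 < 1 / 3 → 0 ≤ l → l ≤ 1 →
      0 < 1 / 4 - e0 / 2 - l * (9 / 4 * e0 ^ 2 / (1 - 3 * e0)) →
      1 ≤ 4 * (1 / 4 - e0 / 2 - l * (9 / 4 * e0 ^ 2 / (1 - 3 * e0))) *
        (K - (1 - l) * (9 / 4 / (1 - 3 * e0))) →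
      ((t : ℝ) - 1) ^ 2 ≤ 4 * (t : ℝ) ^ 3 * e0 ^ 2 →
      (((t : ℝ) - 1) * K + 1 / 2) * ((t : ℝ) - 1) ^ 2 ≤ 4 * (t : ℝ) ^ 3 * (1 - e0) →
      ∃ K : ℝ, 0 ≤ K ∧ e < 1 / 3 ∧
       (((t : ℝ) - 1) * K + 1 / 2) * ((t : ℝ) - 1) ^ 2 ≤ 4 * (t : ℝ) ^ 3 * (1 - e) ∧
       (∀ z : ℝ, 0 ≤ z → z ≤ 1 →
        e * (z + z ^ 2 / 2) + e ^ 2 * (z + z ^ 2 / 2) ^ 2 / (1 - 2 * (e * (z + z ^ 2 / 2))) ≤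
        z ^ 2 / 4 + K * e ^ 2) := by
    intro e0 K l a1 a2 a3 a4 a5 a6 a7 a8 a9
    have hee := mv_eps t e e0 he a1 h ht a8
    refine ⟨K, a2, by linarith, a9.trans ?_, fun z z0 z1 => mv_poly e e0 K l z he hee a3 a4 a5 z0 z1 a6 a7⟩
    apply mul_le_mul_of_nonneg_left (by linarith) (by positivity)
  by_cases h16 : 16 ≤ t
  · have ht' : (16 : ℝ) ≤ t := by exact_mod_cast h16
    set x : ℝ := (t : ℝ)
    refine key (1 / 8) (17 / 5) 1 (by norm_num) (by norm_num) (by norm_num) (by norm_num)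
      (by norm_num) (by norm_num) (by norm_num) ?_ ?_
    · nlinarith [mul_nonneg (sq_nonneg x) (sub_nonneg.2 ht')]
    · nlinarith [mul_nonneg (sq_nonneg x) (sub_nonneg.2 ht')]
  · by_cases h4 : t ≤ 4
    · refine key (77 / 400) 7 0 (by norm_num) (by norm_num) (by norm_num) (by norm_num)
        (by norm_num) (by norm_num) (by norm_num) ?_ ?_ <;>
      · interval_cases t <;> norm_num
    · by_cases h5 : t = 5
      · subst h5
        exact key (179 / 1000) (31 / 5) (3 / 10) (by norm_num) (by norm_num) (by norm_num) (by norm_num)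
          (by norm_num) (by norm_num) (by norm_num) (by norm_num) (by norm_num)
      · by_cases h7 : t ≤ 7
        · refine key (1702 / 10000) (51 / 10) (1 / 2) (by norm_num) (by norm_num) (by norm_num)
            (by norm_num) (by norm_num) (by norm_num) (by norm_num) ?_ ?_ <;>
          · have : 6 ≤ t := by omega
            interval_cases t <;> norm_num
        · refine key (155 / 1000) (41 / 10) (3 / 5) (by norm_num) (by norm_num) (by norm_num)
            (by norm_num) (by norm_num) (by norm_num) (by norm_num) ?_ ?_ <;>
          · have : 8 ≤ t := by omega
            have : t ≤ 15 := by omega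
            interval_cases t <;> norm_num

section mvhelpers2
open Finset

section main
variable {α β : Type} [Fintype α] [Fintype β] [DecidableEq α] [DecidableEq β]

/-- Degree as a real number. -/
noncomputable def mvD (G : SimpleGraph β) [DecidableRel G.Adj] (x : β) : ℝ := (G.degree x : ℝ)

/-- Random walk kernel. -/
noncomputable def mvK (G : SimpleGraph β) [DecidableRel G.Adj] (x y : β) : ℝ :=
  if mvD G x = 0 then (if y = x then 1 else 0) else (if G.Adj x y then 1 / mvD G x else 0)

/-- Bound for the kernel. -/
noncomputable def mvJ (G : SimpleGraph β) [DecidableRel G.Adj] (x : β) : ℝ :=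
  if mvD G x = 0 then 1 else 1 / mvD G x

lemma mvD_nonneg (G : SimpleGraph β) [DecidableRel G.Adj] (x : β) : 0 ≤ mvD G x := by
  unfold mvD; positivity

lemma mvD_pos_of_adj (G : SimpleGraph β) [DecidableRel G.Adj] {x y : β} (h : G.Adj x y) :
    0 < mvD G x := by
  unfold mvD
  exact_mod_cast (G.degree_pos_iff_exists_adj x).2 ⟨y, h⟩

lemma mvK_nonneg (G : SimpleGraph β) [DecidableRel G.Adj] (x y : β) : 0 ≤ mvK G x y := by
  have := mvD_nonneg G x
  unfold mvK; split_ifs <;> positivity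

lemma mvK_le (G : SimpleGraph β) [DecidableRel G.Adj] (x y : β) : mvK G x y ≤ mvJ G x := by
  have := mvD_nonneg G x
  unfold mvK mvJ; split_ifs <;> first | positivity | norm_num

lemma mvK_sum (G : SimpleGraph β) [DecidableRel G.Adj] (x : β) : ∑ y, mvK G x y = 1 := by
  unfold mvK
  split_ifs with h
  · simp
  · rw [← Finset.sum_filter, Finset.sum_const, ← SimpleGraph.neighborFinset_eq_filter,
      SimpleGraph.card_neighborFinset_eq_degree, nsmul_eq_mul]
    unfold mvD at *
    field_simp

/-- Being a homomorphism. -/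
def mvHom (T : SimpleGraph α) (G : SimpleGraph β) (φ : α → β) : Prop :=
  ∀ ⦃u v : α⦄, T.Adj u v → G.Adj (φ u) (φ v)

open Classical in
/-- Root-free form of the weight. -/
noncomputable def mvQc (T : SimpleGraph α) [DecidableRel T.Adj] (G : SimpleGraph β)
    [DecidableRel G.Adj] (φ : α → β) : ℝ :=
  if mvHom T G φ then (∏ v, mvD G (φ v)) /
    ∏ e ∈ T.edgeFinset, Sym2.lift ⟨fun u w => mvD G (φ u) * mvD G (φ w), fun _ _ => mul_comm _ _⟩ e
  else 0

lemma mvQ_eq [Nontrivial α] (T : SimpleGraph α) [DecidableRel T.Adj] (hT : T.IsTree)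
    (G : SimpleGraph β) [DecidableRel G.Adj]
    (p : α) (par : α → α) (rank : α → ℕ) (h1 : ∀ v, v ≠ p → rank (par v) < rank v)
    (h2 : ∀ v, v ≠ p → T.Adj v (par v))
    (h4 : Set.InjOn (fun v => s(v, par v)) (univ.erase p : Finset α))
    (h5 : T.edgeFinset = (univ.erase p).image (fun v => s(v, par v))) (φ : α → β) :
    mvQ (mvD G) (mvK G) p par φ = mvQc T G φ := by
  unfold mvQc
  split_ifs with hh
  · have hpos : ∀ v, mvD G (φ v) ≠ 0 := by
      intro v
      have := hT.connected.preconnected.degree_pos_of_nontrivial v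
      obtain ⟨w, hw⟩ := (T.degree_pos_iff_exists_adj v).1 this
      exact (mvD_pos_of_adj G (hh hw)).ne'
    rw [h5, Finset.prod_image h4, ← Finset.mul_prod_erase univ _ (Finset.mem_univ p)]
    simp only [Sym2.lift_mk]
    rw [Finset.prod_mul_distrib]
    unfold mvQ
    have e1 : ∏ v ∈ univ.erase p, mvK G (φ (par v)) (φ v) =
        ∏ v ∈ univ.erase p, (mvD G (φ (par v)))⁻¹ := by
      refine Finset.prod_congr rfl fun v hv => ?_
      unfold mvK
      rw [if_neg (hpos _), if_pos (hh (h2 v (Finset.ne_of_mem_erase hv))).symm, one_div]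
    rw [e1, Finset.prod_inv_distrib]
    have n1 : ∏ v ∈ univ.erase p, mvD G (φ v) ≠ 0 := Finset.prod_ne_zero_iff.2 fun v _ => hpos v
    have n2 : ∏ v ∈ univ.erase p, mvD G (φ (par v)) ≠ 0 :=
      Finset.prod_ne_zero_iff.2 fun v _ => hpos _
    field_simp
  · by_contra hQ
    unfold mvQ at hQ
    have hp : mvD G (φ p) ≠ 0 := left_ne_zero_of_mul hQ
    have hk := Finset.prod_ne_zero_iff.1 (right_ne_zero_of_mul hQ)
    have hadj : ∀ v, v ≠ p → mvD G (φ (par v)) ≠ 0 → G.Adj (φ (par v)) (φ v) := by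
      intro v hv hD
      have := hk v (by simp [hv])
      unfold mvK at this
      rw [if_neg hD] at this
      by_contra hc
      rw [if_neg hc] at this
      exact this rfl
    have hall : ∀ k v, rank v = k → mvD G (φ v) ≠ 0 := by
      intro k
      induction k using Nat.strong_induction_on with
      | _ k ih =>
        intro v hv
        by_cases hvp : v = p
        · rw [hvp]; exact hp
        · have h3 := h1 v hvp
          have := hadj v hvp (ih _ (hv ▸ h3) _ rfl)
          exact (mvD_pos_of_adj G this.symm).ne'
    apply hh
    intro u w huw
    have : s(u, w) ∈ T.edgeFinset := by simpa using huw
    rw [h5] at this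
    obtain ⟨v, hv, hvv⟩ := Finset.mem_image.1 this
    have hvp := Finset.ne_of_mem_erase hv
    have hgv := hadj v hvp (hall _ _ rfl)
    simp only [Sym2.eq_iff] at hvv
    rcases hvv with ⟨rfl, rfl⟩ | ⟨rfl, rfl⟩
    · exact hgv.symm
    · exact hgv

lemma mvQc_marg [Nontrivial α] [Nonempty β] (T : SimpleGraph α) [DecidableRel T.Adj] (hT : T.IsTree)
    (G : SimpleGraph β) [DecidableRel G.Adj] (p : α) (g : β → ℝ) :
    ∑ φ : α → β, mvQc T G φ * g (φ p) = ∑ x, mvD G x * g x := by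
  obtain ⟨par, rank, h1, h2, h3, h4, h5⟩ := mv_tree_par T hT p
  simp only [← mvQ_eq T hT G p par rank h1 h2 h4 h5]
  exact mv_marg _ _ (mvK_sum G) p par rank h1 g

lemma mvQc_pair [Nontrivial α] [Nonempty β] (T : SimpleGraph α) [DecidableRel T.Adj] (hT : T.IsTree)
    (G : SimpleGraph β) [DecidableRel G.Adj] (p : α) (g : β → ℝ) (hg : ∀ x, 0 ≤ g x)
    (a b : α) (hab : a ≠ b) :
    ∃ c : α, ∑ φ : α → β, mvQc T G φ * (g (φ p) * if φ a = φ b then 1 else 0) ≤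
      ∑ φ : α → β, mvQc T G φ * (g (φ p) * mvJ G (φ c)) := by
  obtain ⟨par, rank, h1, h2, h3, h4, h5⟩ := mv_tree_par T hT p
  simp only [← mvQ_eq T hT G p par rank h1 h2 h4 h5]
  have main : ∀ a b : α, a ≠ b → rank a ≤ rank b →
      ∑ φ : α → β, mvQ (mvD G) (mvK G) p par φ * (g (φ p) * if φ a = φ b then 1 else 0) ≤
      ∑ φ : α → β, mvQ (mvD G) (mvK G) p par φ * (g (φ p) * mvJ G (φ (par b))) := by
    intro a b hab hle
    refine mv_pair _ (mvD_nonneg G) _ (mvK_nonneg G) (mvK_sum G) _ (mvK_le G) p par rank h1 g hg a b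
      hab ?_ hle
    rintro rfl
    have := (h3 b).2 rfl
    exact hab ((h3 a).1 (by omega))
  rcases le_total (rank a) (rank b) with h | h
  · exact ⟨par b, main a b hab h⟩
  · refine ⟨par a, ?_⟩
    have := main b a hab.symm h
    simpa only [eq_comm] using this

lemma mvQc_nonneg (T : SimpleGraph α) [DecidableRel T.Adj]
    (G : SimpleGraph β) [DecidableRel G.Adj] (φ : α → β) : 0 ≤ mvQc T G φ := by
  unfold mvQc
  split_ifs
  · apply div_nonneg
    · exact Finset.prod_nonneg fun _ _ => mvD_nonneg G _
    · refine Finset.prod_nonneg fun e _ => ?_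
      induction e with
      | _ u w => exact mul_nonneg (mvD_nonneg G _) (mvD_nonneg G _)
  · exact le_rfl

lemma mvHom_pos [Nontrivial α] (T : SimpleGraph α) [DecidableRel T.Adj] (hT : T.IsTree)
    (G : SimpleGraph β) [DecidableRel G.Adj] (φ : α → β) (hh : mvHom T G φ) (v : α) :
    0 < mvD G (φ v) := by
  have := hT.connected.preconnected.degree_pos_of_nontrivial v
  obtain ⟨w, hw⟩ := (T.degree_pos_iff_exists_adj v).1 this
  exact mvD_pos_of_adj G (hh hw)

/-- The weight is the inverse of a product of `t-1` degrees. -/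
lemma mvQc_inv [Nontrivial α] (T : SimpleGraph α) [DecidableRel T.Adj] (hT : T.IsTree)
    (G : SimpleGraph β) [DecidableRel G.Adj] :
    ∃ (C : Finset α) (par : α → α), C.card + 2 = Fintype.card α ∧
      ∀ φ : α → β, mvHom T G φ → mvQc T G φ * ∏ v ∈ C, mvD G (φ (par v)) = 1 := by
  obtain ⟨p⟩ := hT.connected.nonempty
  obtain ⟨par, rank, h1, h2, h3, h4, h5⟩ := mv_tree_par T hT p
  have hc : ∃ c, c ≠ p ∧ par c = p := by
    have := hT.connected.preconnected.degree_pos_of_nontrivial p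
    obtain ⟨w, hw⟩ := (T.degree_pos_iff_exists_adj p).1 this
    have : s(p, w) ∈ T.edgeFinset := by simpa using hw
    rw [h5] at this
    obtain ⟨v, hv, hvv⟩ := Finset.mem_image.1 this
    have hvp := Finset.ne_of_mem_erase hv
    simp only [Sym2.eq_iff] at hvv
    rcases hvv with h | h
    · exact absurd h.1 hvp
    · exact ⟨v, hvp, h.2⟩
  obtain ⟨c, hcp, hc⟩ := hc
  have hmem : c ∈ (univ.erase p : Finset α) := by simp [hcp]
  refine ⟨(univ.erase p).erase c, par, ?_, ?_⟩
  · have e1 := Finset.card_erase_add_one hmem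
    have e2 := Finset.card_erase_add_one (Finset.mem_univ p)
    rw [Finset.card_univ] at e2
    omega
  · intro φ hh
    have hpos := mvHom_pos T hT G φ hh
    rw [← mvQ_eq T hT G p par rank h1 h2 h4 h5]
    unfold mvQ
    have e1 : ∏ v ∈ univ.erase p, mvK G (φ (par v)) (φ v) =
        ∏ v ∈ univ.erase p, (mvD G (φ (par v)))⁻¹ := by
      refine Finset.prod_congr rfl fun v hv => ?_
      unfold mvK
      rw [if_neg (hpos _).ne', if_pos (hh (h2 v (Finset.ne_of_mem_erase hv))).symm, one_div]
    rw [e1, ← Finset.mul_prod_erase _ _ hmem, hc, Finset.prod_inv_distrib]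
    have n2 : ∏ v ∈ (univ.erase p).erase c, mvD G (φ (par v)) ≠ 0 :=
      Finset.prod_ne_zero_iff.2 fun v _ => (hpos _).ne'
    have := (hpos p).ne'
    field_simp

end main

section final
variable {α β : Type} [Fintype α] [Fintype β] [DecidableEq α] [DecidableEq β]

lemma mv_card_pairs (T : SimpleGraph α) [DecidableRel T.Adj] (hT : T.IsTree) (t : ℕ)
    (hcard : Fintype.card α = t + 1) :
    (((univ : Finset (α × α)).filter (fun q => q.1 ≠ q.2 ∧ ¬ T.Adj q.1 q.2)).card : ℝ) =
      (t : ℝ) * ((t : ℝ) - 1) := by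
  rw [Finset.card_filter]
  push_cast
  rw [Fintype.sum_prod_type]
  have e : ∀ a b : α, (if a ≠ b ∧ ¬ T.Adj a b then (1 : ℝ) else 0) =
      1 - (if a = b then 1 else 0) - (if T.Adj a b then 1 else 0) := by
    intro a b
    by_cases h1 : a = b
    · subst h1; simp
    · by_cases h2 : T.Adj a b <;> simp [h1, h2]
  simp only [e, Finset.sum_sub_distrib]
  have hdeg : ∑ a : α, ∑ b : α, (if T.Adj a b then (1 : ℝ) else 0) = 2 * t := by
    have h1 : ∀ a : α, ∑ b : α, (if T.Adj a b then (1 : ℝ) else 0) = (T.degree a : ℝ) := by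
      intro a
      rw [← Finset.sum_filter, Finset.sum_const, ← SimpleGraph.neighborFinset_eq_filter,
        SimpleGraph.card_neighborFinset_eq_degree, nsmul_eq_mul, mul_one]
    simp only [h1]
    have h2 := T.sum_degrees_eq_twice_card_edges
    have h3 := hT.card_edgeFinset
    have h4 : ∑ a, T.degree a = 2 * t := by rw [h2]; omega
    exact_mod_cast h4
  rw [hdeg]
  simp [hcard]
  ring

open Classical in
lemma mv_pointwise [Nontrivial α] (T : SimpleGraph α) [DecidableRel T.Adj]
    (hT : T.IsTree) (G : SimpleGraph β) [DecidableRel G.Adj] (d : ℝ) (hd : 0 < d)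
    (C : Finset α) (par : α → α)
    (hinv : ∀ φ : α → β, mvHom T G φ → mvQc T G φ * ∏ v ∈ C, mvD G (φ (par v)) = 1) (φ : α → β) :
    d ^ C.card * (mvQc T G φ * (1 + ∑ v ∈ C, mvPhi (mvD G (φ (par v)) / d)) -
      1 / 2 * ∑ q ∈ (univ : Finset (α × α)).filter (fun q => q.1 ≠ q.2 ∧ ¬ T.Adj q.1 q.2),
        (mvQc T G φ * (1 * if φ q.1 = φ q.2 then 1 else 0) +
          ∑ v ∈ C, mvQc T G φ * (max 0 (mvPhi (mvD G (φ (par v)) / d)) *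
            if φ q.1 = φ q.2 then 1 else 0))) ≤
      if Function.Injective φ ∧ mvHom T G φ then 1 else 0 := by
  by_cases hh : mvHom T G φ
  swap
  · have : mvQc T G φ = 0 := by unfold mvQc; rw [if_neg hh]
    simp [this, hh]
  have hQ := mvQc_nonneg T G φ
  have hpos := mvHom_pos T hT G φ hh
  by_cases hi : Function.Injective φ
  · rw [if_pos ⟨hi, hh⟩]
    have hz : ∀ q ∈ (univ : Finset (α × α)).filter (fun q => q.1 ≠ q.2 ∧ ¬ T.Adj q.1 q.2),
        (mvQc T G φ * (1 * if φ q.1 = φ q.2 then 1 else 0) +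
          ∑ v ∈ C, mvQc T G φ * (max 0 (mvPhi (mvD G (φ (par v)) / d)) *
            if φ q.1 = φ q.2 then 1 else 0)) = 0 := by
      intro q hq
      have : φ q.1 ≠ φ q.2 := fun h => (Finset.mem_filter.1 hq).2.1 (hi h)
      simp [this]
    rw [Finset.sum_eq_zero hz, mul_zero, sub_zero]
    refine le_of_le_of_eq ?_ (hinv φ hh)
    have hprod : ∏ v ∈ C, mvD G (φ (par v)) = d ^ C.card * ∏ v ∈ C, (mvD G (φ (par v)) / d) := by
      rw [Finset.prod_div_distrib, Finset.prod_const]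
      field_simp
    have hlog : 1 + ∑ v ∈ C, mvPhi (mvD G (φ (par v)) / d) ≤ ∏ v ∈ C, (mvD G (φ (par v)) / d) := by
      have hy : ∀ v, 0 < mvD G (φ (par v)) / d := fun v => div_pos (hpos _) hd
      have h1 : ∑ v ∈ C, mvPhi (mvD G (φ (par v)) / d) ≤
          Real.log (∏ v ∈ C, (mvD G (φ (par v)) / d)) := by
        rw [Real.log_prod (fun v _ => (hy v).ne')]
        exact Finset.sum_le_sum fun v _ => mvPhi_le_log (hy v)
      have h2 := Real.log_le_sub_one_of_pos (Finset.prod_pos (s := C) (fun v _ => hy v))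
      linarith
    rw [hprod]
    have := mul_le_mul_of_nonneg_left hlog (mul_nonneg (pow_nonneg hd.le C.card) hQ)
    linarith
  · rw [if_neg (fun h => hi h.1)]
    apply mul_nonpos_of_nonneg_of_nonpos (by positivity)
    set R := mvQc T G φ * (1 + ∑ v ∈ C, max 0 (mvPhi (mvD G (φ (par v)) / d))) with hR
    have hR0 : 0 ≤ R := by
      apply mul_nonneg hQ
      have : 0 ≤ ∑ v ∈ C, max 0 (mvPhi (mvD G (φ (par v)) / d)) :=
        Finset.sum_nonneg fun _ _ => le_max_left _ _
      linarith
    have hterm : ∀ q : α × α, (mvQc T G φ * (1 * if φ q.1 = φ q.2 then 1 else 0) +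
          ∑ v ∈ C, mvQc T G φ * (max 0 (mvPhi (mvD G (φ (par v)) / d)) *
            if φ q.1 = φ q.2 then 1 else 0)) = R * if φ q.1 = φ q.2 then 1 else 0 := by
      intro q
      rw [hR, ← Finset.mul_sum, ← Finset.sum_mul]
      ring
    simp only [hterm]
    have hle : mvQc T G φ * (1 + ∑ v ∈ C, mvPhi (mvD G (φ (par v)) / d)) ≤ R := by
      apply mul_le_mul_of_nonneg_left _ hQ
      have := Finset.sum_le_sum (s := C)
        (fun v _ => le_max_right 0 (mvPhi (mvD G (φ (par v)) / d)))
      linarith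
    simp only [Function.Injective, not_forall] at hi
    obtain ⟨a, b, hab, hne⟩ := hi
    have hnadj : ¬ T.Adj a b := by
      intro h
      have := hh h
      rw [hab] at this
      exact G.loopless.irrefl _ this
    have hnadj' : ¬ T.Adj b a := fun h => hnadj h.symm
    have hsub : ({(a, b), (b, a)} : Finset (α × α)) ⊆
        (univ : Finset (α × α)).filter (fun q => q.1 ≠ q.2 ∧ ¬ T.Adj q.1 q.2) := by
      intro q hq
      simp only [Finset.mem_insert, Finset.mem_singleton] at hq
      rcases hq with rfl | rfl
      · simp [hne, hnadj]
      · simp [Ne.symm hne, hnadj']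
    have hge := Finset.sum_le_sum_of_subset_of_nonneg hsub
      (f := fun q : α × α => R * if φ q.1 = φ q.2 then 1 else 0)
      (fun q _ _ => by positivity)
    rw [Finset.sum_pair (by simp [hne])] at hge
    simp only [hab, if_true, mul_one] at hge
    linarith

open Classical in
lemma mv_core [Nontrivial α] [Nonempty β] (T : SimpleGraph α) [DecidableRel T.Adj]
    (hT : T.IsTree) (G : SimpleGraph β) [DecidableRel G.Adj] (t : ℕ)
    (hcard : Fintype.card α = t + 1) (d : ℝ) (hd : 0 < d)
    (hsum : ∑ x, mvD G x = (Fintype.card β : ℝ) * d) (K e : ℝ)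
    (he : e * d = (t : ℝ) * ((t : ℝ) - 1) / 2)
    (hpoint : ∀ y y' : ℝ, 0 < y → 0 < y' →
      e * (max 0 (mvPhi y) / y') ≤ mvq y / 2 + mvq y' / 2 + K * e ^ 2) :
    (Fintype.card β : ℝ) * d ^ t * (1 - e - ((t : ℝ) - 1) * K * e ^ 2) ≤
      ∑ φ : α → β, if Function.Injective φ ∧ mvHom T G φ then 1 else 0 := by
  obtain ⟨C, par, hC, hinv⟩ := mvQc_inv T hT G
  have hCt : C.card + 1 = t := by omega
  have hCr : (C.card : ℝ) = (t : ℝ) - 1 := by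
    rw [← hCt]; push_cast; ring
  have hstep := Finset.sum_le_sum (s := (univ : Finset (α → β)))
    (fun φ _ => mv_pointwise T hT G d hd C par hinv φ)
  refine le_trans ?_ hstep
  have hcp := mv_card_pairs T hT t hcard
  set PS := (univ : Finset (α × α)).filter (fun q => q.1 ≠ q.2 ∧ ¬ T.Adj q.1 q.2) with hPS
  set n : ℝ := (Fintype.card β : ℝ) with hn
  rw [← Finset.mul_sum, Finset.sum_sub_distrib, ← Finset.mul_sum, Finset.sum_comm (t := PS)]
  set Eq : ℝ := ∑ x, mvD G x * mvq (mvD G x / d) with hEq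
  -- main term
  have hA : n * d + (t - 1) * Eq ≤
      ∑ φ : α → β, mvQc T G φ * (1 + ∑ v ∈ C, mvPhi (mvD G (φ (par v)) / d)) := by
    have h1 : ∑ φ : α → β, mvQc T G φ * (1 + ∑ v ∈ C, mvPhi (mvD G (φ (par v)) / d)) =
        n * d + (t - 1) * ∑ x, mvD G x * mvPhi (mvD G x / d) := by
      simp only [mul_add, Finset.sum_add_distrib, Finset.mul_sum]
      rw [Finset.sum_comm]
      have hone := mvQc_marg T hT G (Classical.arbitrary α) (fun _ => 1)
      rw [hone]
      have : ∀ v ∈ C, ∑ φ : α → β, mvQc T G φ * mvPhi (mvD G (φ (par v)) / d) =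
          ∑ x, mvD G x * mvPhi (mvD G x / d) := fun v _ =>
        mvQc_marg T hT G (par v) (fun x => mvPhi (mvD G x / d))
      rw [Finset.sum_congr rfl this, Finset.sum_const, nsmul_eq_mul, hCr]
      simp only [mul_one, hsum, Finset.mul_sum]
    rw [h1]
    have h2 : Eq ≤ ∑ x, mvD G x * mvPhi (mvD G x / d) := by
      have h3 : ∑ x, (mvD G x - d) ≤
          ∑ x, (mvD G x * mvPhi (mvD G x / d) - mvD G x * mvq (mvD G x / d)) := by
        refine Finset.sum_le_sum fun x _ => ?_
        unfold mvq
        by_cases h : mvD G x = 0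
        · simp [h, hd.le]
        · apply le_of_eq; field_simp; ring
      rw [Finset.sum_sub_distrib, Finset.sum_sub_distrib, hsum] at h3
      simp only [Finset.sum_const, Finset.card_univ, nsmul_eq_mul] at h3
      linarith
    have h4 : (0 : ℝ) ≤ t - 1 := by rw [← hCr]; positivity
    have := mul_le_mul_of_nonneg_left h2 h4
    linarith
  -- pair terms
  have hB1 : ∀ q ∈ PS, ∑ φ : α → β, mvQc T G φ * (1 * if φ q.1 = φ q.2 then 1 else 0) ≤ n := by
    intro q hq
    obtain ⟨c, hc⟩ := mvQc_pair T hT G (Classical.arbitrary α) (fun _ => 1) (fun _ => zero_le_one)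
      q.1 q.2 (Finset.mem_filter.1 hq).2.1
    refine hc.trans ?_
    simp only [one_mul]
    rw [mvQc_marg T hT G c (fun x => mvJ G x)]
    have : ∑ x : β, mvD G x * mvJ G x ≤ ∑ x : β, (1 : ℝ) := by
      refine Finset.sum_le_sum fun x _ => ?_
      unfold mvJ
      split_ifs with h
      · simp [h]
      · rw [mul_one_div_cancel h]
    simpa using this
  set B := Eq + K * e ^ 2 * (n * d) with hBdef
  have hB2 : ∀ q ∈ PS, ∀ v ∈ C, e * d * ∑ φ : α → β, mvQc T G φ *
      (max 0 (mvPhi (mvD G (φ (par v)) / d)) * if φ q.1 = φ q.2 then 1 else 0) ≤ B := by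
    intro q hq v _
    obtain ⟨c, hc⟩ := mvQc_pair T hT G (par v) (fun x => max 0 (mvPhi (mvD G x / d)))
      (fun _ => le_max_left _ _) q.1 q.2 (Finset.mem_filter.1 hq).2.1
    have hed : 0 ≤ e * d := by
      rw [he]
      have h4 : (0 : ℝ) ≤ t - 1 := by rw [← hCr]; positivity
      positivity
    refine (mul_le_mul_of_nonneg_left hc hed).trans ?_
    rw [Finset.mul_sum]
    have hle : ∀ φ ∈ (univ : Finset (α → β)), e * d * (mvQc T G φ *
        (max 0 (mvPhi (mvD G (φ (par v)) / d)) * mvJ G (φ c))) ≤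
        mvQc T G φ * (mvq (mvD G (φ (par v)) / d) / 2) + mvQc T G φ * (mvq (mvD G (φ c) / d) / 2) +
        mvQc T G φ * (K * e ^ 2) := by
      intro φ _
      by_cases hh : mvHom T G φ
      · have hpos := mvHom_pos T hT G φ hh
        have h5 := hpoint _ _ (div_pos (hpos (par v)) hd) (div_pos (hpos c) hd)
        have h6 := mul_le_mul_of_nonneg_left h5 (mvQc_nonneg T G φ)
        have h7 : mvJ G (φ c) = 1 / mvD G (φ c) := by unfold mvJ; rw [if_neg (hpos c).ne']
        rw [h7]
        have h8 := (hpos c).ne'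
        calc _ = mvQc T G φ * (e * (max 0 (mvPhi (mvD G (φ (par v)) / d)) / (mvD G (φ c) / d))) := by
              field_simp
          _ ≤ _ := h6
          _ = _ := by ring
      · have : mvQc T G φ = 0 := by unfold mvQc; rw [if_neg hh]
        simp [this]
    refine (Finset.sum_le_sum hle).trans ?_
    rw [Finset.sum_add_distrib, Finset.sum_add_distrib,
      mvQc_marg T hT G (par v) (fun x => mvq (mvD G x / d) / 2),
      mvQc_marg T hT G c (fun x => mvq (mvD G x / d) / 2),
      mvQc_marg T hT G c (fun x => K * e ^ 2), ← Finset.sum_mul, hsum, hBdef, hEq]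
    have : ∑ x, mvD G x * (mvq (mvD G x / d) / 2) = (∑ x, mvD G x * mvq (mvD G x / d)) / 2 := by
      rw [Finset.sum_div]
      exact Finset.sum_congr rfl fun x _ => by ring
    rw [this]
    apply le_of_eq; ring
  have hPair : 1 / 2 * ∑ q ∈ PS, ∑ φ : α → β,
      (mvQc T G φ * (1 * if φ q.1 = φ q.2 then 1 else 0) +
          ∑ v ∈ C, mvQc T G φ * (max 0 (mvPhi (mvD G (φ (par v)) / d)) *
            if φ q.1 = φ q.2 then 1 else 0)) ≤ e * d * n + (t - 1) * B := by
    have h1 : ∀ q ∈ PS, ∑ φ : α → β,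
      (mvQc T G φ * (1 * if φ q.1 = φ q.2 then 1 else 0) +
          ∑ v ∈ C, mvQc T G φ * (max 0 (mvPhi (mvD G (φ (par v)) / d)) *
            if φ q.1 = φ q.2 then 1 else 0)) ≤ n + (t - 1) * (B / (e * d)) := by
      intro q hq
      rw [Finset.sum_add_distrib, Finset.sum_comm]
      apply add_le_add (hB1 q hq)
      rw [← hCr, ← nsmul_eq_mul]
      refine Finset.sum_le_card_nsmul _ _ _ fun v hv => ?_
      have h2 := hB2 q hq v hv
      have hCpos : 0 < C.card := Finset.card_pos.2 ⟨v, hv⟩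
      have hed : 0 < e * d := by
        rw [he, ← hCr]
        have : 0 < t := by omega
        positivity
      rw [le_div_iff₀ hed]
      linarith
    have h2 := Finset.sum_le_card_nsmul PS _ _ h1
    rw [nsmul_eq_mul, hcp] at h2
    have h3 : (t : ℝ) * (t - 1) = 2 * (e * d) := by rw [he]; ring
    rw [h3] at h2
    have h4 : e * d * ((t - 1) * (B / (e * d))) = (t - 1) * B := by
      by_cases hz : e * d = 0
      · have : (t : ℝ) - 1 = 0 := by
          rw [hz] at h3
          have ht0 : (t : ℝ) ≠ 0 := by
            have : t ≠ 0 := by omega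
            exact_mod_cast this
          simpa [ht0] using h3
        rw [this]; simp
      · rw [mul_left_comm, mul_div_cancel₀ _ hz]
    linarith
  have hfin : n * d * (1 - e - (t - 1) * K * e ^ 2) ≤
      (n * d + (t - 1) * Eq) - (e * d * n + (t - 1) * B) := by
    apply le_of_eq; rw [hBdef]; ring
  have hpw : d ^ t = d ^ C.card * d := by rw [← hCt, pow_succ]
  calc n * d ^ t * (1 - e - (t - 1) * K * e ^ 2)
      = d ^ C.card * (n * d * (1 - e - (t - 1) * K * e ^ 2)) := by rw [hpw]; ring
    _ ≤ _ := by
      apply mul_le_mul_of_nonneg_left _ (by positivity)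
      linarith

end final

lemma mv_fall (t : ℕ) (d : ℝ) (hd : 0 < d) (htd : (t : ℝ) ≤ d) :
    ∏ i ∈ Finset.range t, (d - (i : ℝ)) ≤ d ^ t * (1 - (t : ℝ) * (t - 1) / 2 / d +
      ((t : ℝ) * (t - 1) / 2 / d) ^ 2 / 2) := by
  induction t with
  | zero => simp
  | succ k ih =>
    have hk : (k : ℝ) ≤ d := by push_cast at htd; linarith
    have h := ih hk
    rw [Finset.prod_range_succ]
    refine (mul_le_mul_of_nonneg_right h (by linarith)).trans ?_
    set x : ℝ := (k : ℝ) / d with hx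
    have e1 : d - (k : ℝ) = d * (1 - x) := by rw [hx]; field_simp
    set s : ℝ := (k : ℝ) * (k - 1) / 2 / d with hs
    have e2 : ((k + 1 : ℕ) : ℝ) * (((k + 1 : ℕ) : ℝ) - 1) / 2 / d = s + x := by
      rw [hs, hx]; push_cast; field_simp; ring
    rw [e1, e2, pow_succ]
    have hx0 : 0 ≤ x := by positivity
    have hp : 0 < d ^ k * d := by positivity
    have : (1 - s + s ^ 2 / 2) * (1 - x) ≤ 1 - (s + x) + (s + x) ^ 2 / 2 := by
      nlinarith [mul_nonneg (sq_nonneg s) hx0, sq_nonneg x]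
    calc _ = d ^ k * d * ((1 - s + s ^ 2 / 2) * (1 - x)) := by ring
      _ ≤ _ := mul_le_mul_of_nonneg_left this hp.le

end mvhelpers2

open Classical in
lemma mv_hom_count {α β : Type} [Fintype α] [Fintype β] (T : SimpleGraph α) (G : SimpleGraph β) :
    (monCount T G : ℝ) =
      ∑ φ : α → β, if Function.Injective φ ∧ mvHom T G φ then (1 : ℝ) else 0 := by
  rw [← Finset.sum_filter, Finset.sum_const, nsmul_eq_mul, mul_one]
  unfold monCount
  rw [Nat.card_eq_fintype_card, Fintype.card_subtype]
  unfold mvHom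
  congr!

/-- Mubayi–Verstraëte: if `T` is a tree with `t` edges and `G` has average degree `d ≥ t`,
then `|Mon(T,G)| ≥ n·(1 - t⁵/d²)·d(d-1)⋯(d-t+1)`. -/
theorem mubayi_verstraete_bound (t : ℕ) (ht : 1 ≤ t)
    (α β : Type) [Fintype α] [Fintype β]
    (T : SimpleGraph α) (G : SimpleGraph β)
    (hT : T.IsTree) (hcard : Fintype.card α = t + 1)
    (hd : (t : ℝ) ≤ avgDeg G) :
    (Fintype.card β : ℝ) * (1 - (t : ℝ) ^ 5 / avgDeg G ^ 2) * fallFact (avgDeg G) t ≤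
      (monCount T G : ℝ) := by
  classical
  set d := avgDeg G with hdd
  have ht1 : (1 : ℝ) ≤ t := by exact_mod_cast ht
  have hd0 : 0 < d := by linarith
  have hfall0 : 0 ≤ fallFact d t := by
    unfold fallFact
    refine Finset.prod_nonneg fun i hi => ?_
    have : i < t := Finset.mem_range.1 hi
    have : (i : ℝ) ≤ t := by exact_mod_cast this.le
    linarith
  by_cases htriv : d ^ 2 < (t : ℝ) ^ 5
  · have h1 : 1 - (t : ℝ) ^ 5 / d ^ 2 ≤ 0 := by
      have : 1 ≤ (t : ℝ) ^ 5 / d ^ 2 := by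
        rw [le_div_iff₀ (by positivity)]; linarith
      linarith
    have h2 : (Fintype.card β : ℝ) * (1 - (t : ℝ) ^ 5 / d ^ 2) * fallFact d t ≤ 0 :=
      mul_nonpos_of_nonpos_of_nonneg
        (mul_nonpos_of_nonneg_of_nonpos (by positivity) h1) hfall0
    exact h2.trans (by positivity)
  push Not at htriv
  have hn0 : (Fintype.card β : ℝ) ≠ 0 := by
    intro h
    rw [hdd] at hd0
    unfold avgDeg at hd0
    rw [h] at hd0
    simp at hd0
  have hne : Nonempty β := by
    rw [← Fintype.card_pos_iff, Nat.pos_iff_ne_zero]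
    exact_mod_cast hn0
  have hnt : Nontrivial α := by
    rw [← Fintype.one_lt_card_iff_nontrivial]; omega
  have hsum : ∑ x, mvD G x = (Fintype.card β : ℝ) * d := by
    have h1 := G.sum_degrees_eq_twice_card_edges
    have h2 : Nat.card G.edgeSet = G.edgeFinset.card := by
      rw [Nat.card_eq_fintype_card, SimpleGraph.edgeFinset_card]
    rw [hdd]
    unfold avgDeg mvD
    rw [mul_div_cancel₀ _ hn0, h2]
    exact_mod_cast h1
  set e : ℝ := (t : ℝ) * (t - 1) / 2 / d with he
  have hed : e * d = (t : ℝ) * ((t : ℝ) - 1) / 2 := by rw [he]; field_simp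
  have hsub0 : (0 : ℝ) ≤ t - 1 := by linarith
  have he0 : 0 ≤ e := by rw [he]; positivity
  rw [mv_hom_count]
  have hfall := mv_fall t d hd0 hd
  rw [← he] at hfall
  change fallFact d t ≤ _ at hfall
  have hfac : 0 ≤ 1 - (t : ℝ) ^ 5 / d ^ 2 := by
    have : (t : ℝ) ^ 5 / d ^ 2 ≤ 1 := by rw [div_le_one (by positivity)]; exact htriv
    linarith
  have hLHS : (Fintype.card β : ℝ) * (1 - (t : ℝ) ^ 5 / d ^ 2) * fallFact d t ≤
      (Fintype.card β : ℝ) * d ^ t * ((1 - (t : ℝ) ^ 5 / d ^ 2) * (1 - e + e ^ 2 / 2)) := by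
    refine (mul_le_mul_of_nonneg_left hfall (mul_nonneg (by positivity) hfac)).trans
      (le_of_eq (by ring))
  -- it suffices to find a good constant
  obtain ⟨K, hK0, he13, hKt, hpoly⟩ : ∃ K : ℝ, 0 ≤ K ∧ e < 1 / 3 ∧
     (1 - (t : ℝ) ^ 5 / d ^ 2) * (1 - e + e ^ 2 / 2) ≤ 1 - e - ((t : ℝ) - 1) * K * e ^ 2 ∧
     (∀ z : ℝ, 0 ≤ z → z ≤ 1 →
      e * (z + z ^ 2 / 2) + e ^ 2 * (z + z ^ 2 / 2) ^ 2 / (1 - 2 * (e * (z + z ^ 2 / 2))) ≤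
      z ^ 2 / 4 + K * e ^ 2) := by
    rcases Nat.eq_or_lt_of_le ht with h1 | h2
    · have hez : e = 0 := by rw [he, ← h1]; simp
      refine ⟨0, le_rfl, by rw [hez]; norm_num, ?_, ?_⟩
      · rw [hez]
        have : 0 ≤ (t : ℝ) ^ 5 / d ^ 2 := by positivity
        simp only [sub_zero]; norm_num; exact this
      · intro z _ _; rw [hez]; simp; positivity
    · have hts : (t : ℝ) ^ 5 / d ^ 2 * (t - 1) ^ 2 = 4 * (t : ℝ) ^ 3 * e ^ 2 := by
        rw [he]; field_simp; ring
      have hle1 : (t : ℝ) ^ 5 / d ^ 2 ≤ 1 := by linarith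
      have hh : 4 * (t : ℝ) ^ 3 * e ^ 2 ≤ ((t : ℝ) - 1) ^ 2 := by
        rw [← hts]
        have := mul_le_mul_of_nonneg_right hle1 (sq_nonneg ((t : ℝ) - 1))
        linarith
      obtain ⟨K, k1, k2, k3, k4⟩ := mv_const t h2 e he0 hh
      refine ⟨K, k1, k2, ?_, k4⟩
      have hspos : (0 : ℝ) < t - 1 := by
        have : (2 : ℝ) ≤ t := by exact_mod_cast h2
        linarith
      have hsq : (0 : ℝ) < (t - 1) ^ 2 := by positivity
      set τ := (t : ℝ) ^ 5 / d ^ 2 with hτ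
      have hτ0 : 0 ≤ τ := by positivity
      have h5 : (((t : ℝ) - 1) * K + 1 / 2) * e ^ 2 ≤ τ * (1 - e) := by
        refine le_of_mul_le_mul_right ?_ hsq
        have := mul_le_mul_of_nonneg_right k3 (sq_nonneg e)
        calc _ = (((t : ℝ) - 1) * K + 1 / 2) * (t - 1) ^ 2 * e ^ 2 := by ring
          _ ≤ 4 * (t : ℝ) ^ 3 * (1 - e) * e ^ 2 := this
          _ = (4 * (t : ℝ) ^ 3 * e ^ 2) * (1 - e) := by ring
          _ = _ := by rw [← hts]; ring
      have h6 : 0 ≤ τ * (e ^ 2 / 2) := by positivity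
      linarith
  refine hLHS.trans ?_
  refine le_trans ?_ (mv_core T hT G t hcard d hd0 hsum K e hed
    (mv_point e K he0 he13 hK0 hpoly))
  exact mul_le_mul_of_nonneg_left hKt (by positivity)
end

section
/- Let A be an n×n real symmetric matrix with all entries nonnegative and let z ∈ ℝⁿ be a vector with all entries nonnegative satisfying ⟨z, z⟩ = 1. Then for all odd positive integers s ≤ t with ⟨A^s z, z⟩ > 0, one has ⟨A^t z, z⟩^{1/t} ≥ ⟨A^s z, z⟩^{1/s}; that is, the quantity ⟨A^t z, z⟩^{1/t} is non-decreasing over odd values of t. -/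
open Matrix

lemma jensen_aux {ι : Type*} [Fintype ι] (w g : ι → ℝ) (hw : ∀ i, 0 ≤ w i)
    (hg : ∀ i, 0 < w i → 0 < g i) (W S : ℝ) (hW : ∑ i, w i = W) (hWpos : 0 < W)
    (hS : ∑ i, w i * g i ≤ S) :
    0 < S ∧ ∑ i, w i * Real.log (g i) ≤ W * Real.log (S / W) := by
  have hSpos : 0 < S := by
    refine lt_of_lt_of_le ?_ hS
    obtain ⟨i, _, hi⟩ : ∃ i ∈ Finset.univ, 0 < w i := by
      apply Finset.exists_lt_of_sum_lt (f := fun _ => (0:ℝ))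
      simpa [hW] using hWpos
    apply Finset.sum_pos'
    · intro j _
      rcases (hw j).eq_or_lt with h | h
      · simp [← h]
      · exact (mul_pos h (hg j h)).le
    · exact ⟨i, Finset.mem_univ _, mul_pos hi (hg i hi)⟩
  refine ⟨hSpos, ?_⟩
  have h1 : ∀ i, w i * Real.log (g i) ≤
      (w i * g i) * (W / S) + w i * (Real.log (S / W) - 1) := by
    intro i
    rcases (hw i).eq_or_lt with h | h
    · simp [← h]
    · have hgi := hg i h
      have h2 := Real.log_le_sub_one_of_pos (show 0 < g i * (W / S) by positivity)
      rw [Real.log_mul hgi.ne' (by positivity), ← inv_div S W, Real.log_inv, inv_div] at h2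
      nlinarith
  calc _ ≤ ∑ i, ((w i * g i) * (W / S) + w i * (Real.log (S / W) - 1)) :=
        Finset.sum_le_sum fun i _ => h1 i
    _ = (∑ i, w i * g i) * (W / S) + W * (Real.log (S / W) - 1) := by
        rw [Finset.sum_add_distrib, ← Finset.sum_mul, ← Finset.sum_mul, hW]
    _ ≤ S * (W / S) + W * (Real.log (S / W) - 1) := by gcongr
    _ = _ := by field_simp; ring

lemma mulVec_nonneg_aux {n : ℕ} (A : Matrix (Fin n) (Fin n) ℝ)
    (hAnn : ∀ i j, 0 ≤ A i j) (u : Fin n → ℝ) (hu : ∀ i, 0 ≤ u i) (i : Fin n) :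
    0 ≤ (A *ᵥ u) i := by
  have h : (A *ᵥ u) i = ∑ x, A i x * u x := rfl
  rw [h]
  exact Finset.sum_nonneg fun j _ => mul_nonneg (hAnn i j) (hu j)

lemma step_aux {n : ℕ} (A : Matrix (Fin n) (Fin n) ℝ) (hA : A.IsSymm)
    (hAnn : ∀ i j, 0 ≤ A i j) (u v : Fin n → ℝ) (hu : ∀ i, 0 ≤ u i) (hv : ∀ i, 0 ≤ v i)
    (m m' : ℝ) (hm : (A *ᵥ u) ⬝ᵥ v = m) (hpos : 0 < m)
    (hm' : (A *ᵥ (A *ᵥ u)) ⬝ᵥ (A *ᵥ v) = m') :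
    0 < m' ∧ ∑ y, (A *ᵥ u) y * v y * (Real.log ((A *ᵥ u) y) - Real.log (v y))
      + ∑ x, u x * (A *ᵥ v) x * (Real.log ((A *ᵥ v) x) - Real.log (u x))
      ≤ m * Real.log (m' / m) := by
  have hs : ∀ i j, A i j = A j i := fun i j => hA.apply j i
  have hu' : ∀ i, 0 ≤ (A *ᵥ u) i := mulVec_nonneg_aux A hAnn u hu
  have hv' : ∀ i, 0 ≤ (A *ᵥ v) i := mulVec_nonneg_aux A hAnn v hv
  have eu : ∀ y, (A *ᵥ u) y = ∑ x, A y x * u x := fun y => rfl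
  have ev : ∀ y, (A *ᵥ v) y = ∑ x, A y x * v x := fun y => rfl
  generalize hU : A *ᵥ u = U at *
  generalize hV : A *ᵥ v = V at *
  -- index p = (y, x)
  set w : Fin n × Fin n → ℝ := fun p => A p.1 p.2 * u p.2 * v p.1 with hw
  set g : Fin n × Fin n → ℝ := fun p => (U p.1 / v p.1) * (V p.2 / u p.2) with hgdef
  have hw0 : ∀ p, 0 ≤ w p := fun p =>
    mul_nonneg (mul_nonneg (hAnn _ _) (hu _)) (hv _)
  have key : ∀ p, 0 < w p → 0 < A p.1 p.2 ∧ 0 < u p.2 ∧ 0 < v p.1 ∧ 0 < U p.1 ∧ 0 < V p.2 := by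
    rintro ⟨y, x⟩ h
    have h1 : A y x ≠ 0 := by rintro h0; simp [hw, h0] at h
    have h2 : u x ≠ 0 := by rintro h0; simp [hw, h0] at h
    have h3 : v y ≠ 0 := by rintro h0; simp [hw, h0] at h
    have h1 := lt_of_le_of_ne (hAnn y x) h1.symm
    have h2 := lt_of_le_of_ne (hu x) h2.symm
    have h3 := lt_of_le_of_ne (hv y) h3.symm
    refine ⟨h1, h2, h3, ?_, ?_⟩
    · show 0 < U y
      rw [eu]
      exact Finset.sum_pos' (fun j _ => mul_nonneg (hAnn _ j) (hu j))
        ⟨x, Finset.mem_univ _, mul_pos h1 h2⟩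
    · show 0 < V x
      rw [ev]
      exact Finset.sum_pos' (fun j _ => mul_nonneg (hAnn _ j) (hv j))
        ⟨y, Finset.mem_univ _, mul_pos (by rw [hs]; exact h1) h3⟩
  have hW : ∑ p, w p = m := by
    rw [← hm, Fintype.sum_prod_type]
    simp only [hw, dotProduct, eu, Finset.sum_mul]
  have hS : ∑ p, w p * g p ≤ m' := by
    have : m' = ∑ p : Fin n × Fin n, A p.1 p.2 * U p.1 * V p.2 := by
      rw [← hm', Fintype.sum_prod_type, Finset.sum_comm]
      simp only [dotProduct, mulVec, Finset.sum_mul]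
      refine Finset.sum_congr rfl fun i _ => Finset.sum_congr rfl fun j _ => ?_
      rw [hs i j]
    rw [this]
    refine Finset.sum_le_sum fun p _ => ?_
    rcases (hw0 p).eq_or_lt with h | h
    · rw [← h, zero_mul]
      exact mul_nonneg (mul_nonneg (hAnn _ _) (hu' _)) (hv' _)
    · obtain ⟨h1, h2, h3, h4, h5⟩ := key p h
      apply le_of_eq
      simp only [hw, hgdef]
      field_simp
  obtain ⟨hm'pos, hJ⟩ := jensen_aux w g hw0 (fun p h => by
    obtain ⟨h1, h2, h3, h4, h5⟩ := key p h
    simp only [hgdef]; positivity) m m' hW hpos hS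
  refine ⟨hm'pos, le_trans (le_of_eq ?_) hJ⟩
  have : ∀ p, w p * Real.log (g p) = w p * (Real.log (U p.1) - Real.log (v p.1))
      + w p * (Real.log (V p.2) - Real.log (u p.2)) := by
    intro p
    rcases (hw0 p).eq_or_lt with h | h
    · simp [← h]
    · obtain ⟨h1, h2, h3, h4, h5⟩ := key p h
      simp only [hgdef]
      rw [Real.log_mul (by positivity) (by positivity), Real.log_div h4.ne' h3.ne',
        Real.log_div h5.ne' h2.ne']
      ring
  simp only [this, Finset.sum_add_distrib]
  congr 1
  · rw [Fintype.sum_prod_type]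
    refine Finset.sum_congr rfl fun y _ => ?_
    simp only [hw]
    rw [← Finset.sum_mul, ← Finset.sum_mul, ← eu]
  · rw [Fintype.sum_prod_type, Finset.sum_comm]
    refine Finset.sum_congr rfl fun x _ => ?_
    simp only [hw]
    rw [← Finset.sum_mul, ev, Finset.mul_sum]
    congr 1
    refine Finset.sum_congr rfl fun y _ => ?_
    rw [hs x y]; ring

lemma two_step {n : ℕ} (A : Matrix (Fin n) (Fin n) ℝ) (z : Fin n → ℝ)
    (hA : A.IsSymm) (hAnn : ∀ i j, 0 ≤ A i j) (hz : ∀ i, 0 ≤ z i)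
    (hz1 : z ⬝ᵥ z = 1) (s : ℕ) (hs1 : 1 ≤ s) (hpos : 0 < ((A ^ s) *ᵥ z) ⬝ᵥ z) :
    0 < ((A ^ (s + 2)) *ᵥ z) ⬝ᵥ z ∧
    (((A ^ s) *ᵥ z) ⬝ᵥ z) ^ ((1 : ℝ) / s)
      ≤ (((A ^ (s + 2)) *ᵥ z) ⬝ᵥ z) ^ ((1 : ℝ) / (s + 2 : ℕ)) := by
  set a : ℕ → Fin n → ℝ := fun k => (A ^ k) *ᵥ z with ha
  have hsucc : ∀ k, A *ᵥ a k = a (k + 1) := fun k => by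
    simp only [ha, pow_succ', mulVec_mulVec]
  have ha0 : a 0 = z := by simp [ha]
  have hann : ∀ k i, 0 ≤ a k i := by
    intro k
    induction k with
    | zero => rw [ha0]; exact hz
    | succ k ih =>
      intro i
      rw [← hsucc]
      exact mulVec_nonneg_aux A hAnn _ ih i
  have hdot : ∀ i j, a i ⬝ᵥ a j = ((A ^ (i + j)) *ᵥ z) ⬝ᵥ z := by
    intro i j
    have : (A ^ j)ᵀ = A ^ j := by rw [transpose_pow, hA.eq]
    simp only [ha]
    rw [add_comm, pow_add, ← mulVec_mulVec, dotProduct_comm _ z, dotProduct_mulVec z,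
      ← mulVec_transpose, this, dotProduct_comm]
  set m := ((A ^ s) *ᵥ z) ⬝ᵥ z with hm
  set m' := ((A ^ (s + 2)) *ᵥ z) ⬝ᵥ z with hm'
  set D : ℕ → ℝ := fun i => ∑ y, a i y * a (s - i) y *
    (Real.log (a i y) - Real.log (a (s - i) y)) with hD
  have hstep : ∀ i, i < s → 0 < m' ∧ D (i + 1) - D i ≤ m * Real.log (m' / m) := by
    intro i hi
    obtain ⟨j, rfl⟩ : ∃ j, s = i + 1 + j := ⟨s - (i + 1), by omega⟩
    have := step_aux A hA hAnn (a i) (a j) (hann i) (hann j) m m'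
      (by rw [hsucc, hdot]) hpos (by rw [hsucc, hsucc, hsucc, hdot, hm']; congr 3; ring)
    refine ⟨this.1, le_trans (le_of_eq ?_) this.2⟩
    rw [hsucc, hsucc]
    simp only [hD]
    rw [show i + 1 + j - (i + 1) = j by omega, show i + 1 + j - i = j + 1 by omega,
      sub_eq_add_neg, ← Finset.sum_neg_distrib]
    congr 1
    exact Finset.sum_congr rfl fun x _ => by ring
  have hm'pos := (hstep 0 (by omega)).1
  refine ⟨hm'pos, ?_⟩
  have htel : D s - D 0 ≤ s * (m * Real.log (m' / m)) := by
    rw [← Finset.sum_range_sub]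
    refine (Finset.sum_le_sum fun i hi => (hstep i (Finset.mem_range.1 hi)).2).trans ?_
    simp
  have hkey : ∀ y, 0 < z y * a s y → 0 < z y ∧ 0 < a s y := by
    intro y h
    refine ⟨lt_of_le_of_ne (hz y) ?_, lt_of_le_of_ne (hann s y) ?_⟩ <;>
    · intro h0; simp [← h0] at h
  have hJ := (jensen_aux (fun y => z y * a s y) (fun y => z y / a s y)
    (fun y => mul_nonneg (hz y) (hann s y))
    (fun y h => div_pos (hkey y h).1 (hkey y h).2) m 1
    (by rw [hm, dotProduct_comm]; rfl) hpos (by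
      rw [← hz1]
      refine Finset.sum_le_sum fun y _ => ?_
      rcases (mul_nonneg (hz y) (hann s y)).eq_or_lt with h | h
      · simp only [← h, zero_mul]; exact mul_self_nonneg _
      · have := (hkey y h).2
        apply le_of_eq; field_simp)).2
  have hsum : D s - D 0 = -2 * ∑ y, z y * a s y * Real.log (z y / a s y) := by
    simp only [hD]
    rw [Nat.sub_self, Nat.sub_zero, ha0, ← Finset.sum_sub_distrib, Finset.mul_sum]
    refine Finset.sum_congr rfl fun y _ => ?_
    rcases (mul_nonneg (hz y) (hann s y)).eq_or_lt with h | h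
    · rw [mul_comm (a s y), ← h]; simp
    · rw [Real.log_div (hkey y h).1.ne' (hkey y h).2.ne']; ring
  rw [one_div, Real.log_inv] at hJ
  rw [Real.log_div hm'pos.ne' hpos.ne'] at htel
  have hfin : (s + 2) * Real.log m ≤ s * Real.log m' := by
    have : m * ((s + 2) * Real.log m) ≤ m * (s * Real.log m') := by nlinarith
    exact le_of_mul_le_mul_left this hpos
  have hs0 : (0 : ℝ) < s := by exact_mod_cast hs1
  rw [Real.rpow_def_of_pos hpos, Real.rpow_def_of_pos hm'pos, Real.exp_le_exp]
  push_cast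
  rw [mul_one_div, mul_one_div, div_le_div_iff₀ hs0 (by positivity)]
  linarith

/-- Erdős–Simonovits / Sağlam monotonicity: for an entrywise nonnegative symmetric matrix `A`
and an entrywise nonnegative unit vector `z`, the quantity `⟨Aᵗz, z⟩^(1/t)` is non-decreasing
over odd values of `t`. -/
theorem odd_moment_monotone (n : ℕ) (A : Matrix (Fin n) (Fin n) ℝ) (z : Fin n → ℝ)
    (hA : A.IsSymm) (hAnn : ∀ i j, 0 ≤ A i j) (hz : ∀ i, 0 ≤ z i)
    (hz1 : z ⬝ᵥ z = 1)
    (s t : ℕ) (hs1 : 1 ≤ s) (hsodd : Odd s) (htodd : Odd t) (hst : s ≤ t)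
    (hpos : 0 < ((A ^ s) *ᵥ z) ⬝ᵥ z) :
    (((A ^ s) *ᵥ z) ⬝ᵥ z) ^ ((1 : ℝ) / s) ≤ (((A ^ t) *ᵥ z) ⬝ᵥ z) ^ ((1 : ℝ) / t) := by
  obtain ⟨k, rfl⟩ : ∃ k, t = s + 2 * k := by
    obtain ⟨p, rfl⟩ := hsodd
    obtain ⟨q, rfl⟩ := htodd
    exact ⟨q - p, by omega⟩
  have main : ∀ k : ℕ, 0 < ((A ^ (s + 2 * k)) *ᵥ z) ⬝ᵥ z ∧
      (((A ^ s) *ᵥ z) ⬝ᵥ z) ^ ((1 : ℝ) / s)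
        ≤ (((A ^ (s + 2 * k)) *ᵥ z) ⬝ᵥ z) ^ ((1 : ℝ) / (s + 2 * k : ℕ)) := by
    intro k
    induction k with
    | zero => exact ⟨hpos, le_rfl⟩
    | succ k ih =>
      have := two_step A z hA hAnn hz hz1 (s + 2 * k) (by omega) ih.1
      exact ⟨this.1, ih.2.trans this.2⟩
  exact (main k).2
end
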